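/- arXiv:1106.2461 — 2 statements merged into one kernel-verified Lean document; each statement's English description precedes it below -/
import Mathlib

section
/- Let S ∈ B⁰(H) and u ∈ H = L²(ℝⁿ, ℂ). Then the orbit { T_X(S) u : X ∈ ℝⁿ × ℝⁿ } is a relatively compact subset of L²(ℝⁿ, ℂ) in the norm topology. -/
open MeasureTheory Filter Topology Matrix
open scoped Pointwise

noncomputable section

/-- Phase space `Ξ = ℝⁿ × (ℝⁿ)*`. -/
abbrev Xi (n : ℕ) := (Fin n → ℝ) × (Fin n → ℝ)

/-- The Hilbert space `H = L²(ℝⁿ, ℂ)`. -/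
abbrev Hn (n : ℕ) := Lp ℂ 2 (volume : Measure (Fin n → ℝ))

/-- `W` is the family of operators given by
`(W(x,ξ)u)(y) = exp(i (y - x/2)·ξ) u(y - x)` (almost everywhere). -/
def IsWeylFamily (n : ℕ) (W : Xi n → (Hn n →L[ℂ] Hn n)) : Prop :=
  ∀ (x ξ : Fin n → ℝ) (u : Hn n), ∀ᵐ y ∂(volume : Measure (Fin n → ℝ)),
    W (x, ξ) u y
      = Complex.exp (Complex.I * (((y - (2⁻¹ : ℝ) • x) ⬝ᵥ ξ : ℝ) : ℂ)) * u (y - x)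

/-- Conjugation `T_X(S) := W(X) S W(X)*`. -/
def Tconj (n : ℕ) (W : Xi n → (Hn n →L[ℂ] Hn n)) (X : Xi n)
    (S : Hn n →L[ℂ] Hn n) : Hn n →L[ℂ] Hn n :=
  W X * S * star (W X)

/-- `B⁰(H)`: the set of `S` whose orbit `X ↦ T_X(S)` is norm-continuous. -/
def B0 (n : ℕ) (W : Xi n → (Hn n →L[ℂ] Hn n)) : Set (Hn n →L[ℂ] Hn n) :=
  {S | Continuous fun X : Xi n => Tconj n W X S}

section Averaging

variable {n : ℕ}

theorem Lp_enorm_sq {α : Type*} [MeasurableSpace α] {μ : Measure α} (f : Lp ℂ 2 μ) :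
    ‖f‖ₑ ^ 2 = ∫⁻ y, ‖f y‖ₑ ^ 2 ∂μ := by
  have h := eLpNorm_nnreal_pow_eq_lintegral (f := f) (μ := μ) (p := 2) two_ne_zero
  simpa [Lp.enorm_def] using h

theorem sq_lintegral_enorm_le {α : Type*} [MeasurableSpace α] {ν : Measure α} {f : α → ℂ}
    (hf : AEStronglyMeasurable f ν) :
    (∫⁻ y, ‖f y‖ₑ ∂ν) ^ 2 ≤ ν Set.univ * ∫⁻ y, ‖f y‖ₑ ^ 2 ∂ν := by
  have h := eLpNorm_le_eLpNorm_mul_rpow_measure_univ (μ := ν) (p := 1) (q := 2) (by norm_num) hf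
  have h2 := eLpNorm_nnreal_pow_eq_lintegral (f := f) (μ := ν) (p := 2) two_ne_zero
  have h2' : eLpNorm f 2 ν ^ 2 = ∫⁻ y, ‖f y‖ₑ ^ 2 ∂ν := by simpa using h2
  rw [eLpNorm_one_eq_lintegral_enorm] at h
  calc _ ≤ _ := pow_le_pow_left₀ zero_le h 2
    _ = _ := by
      rw [mul_pow, h2', mul_comm]
      congr 1
      rw [← ENNReal.rpow_natCast, ← ENNReal.rpow_mul]
      norm_num

theorem ennreal_add_sq_le (a b : ENNReal) : (a + b) ^ 2 ≤ 2 * a ^ 2 + 2 * b ^ 2 := by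
  have h := ENNReal.rpow_add_le_mul_rpow_add_rpow a b (p := 2) (by norm_num)
  rw [← mul_add]
  norm_num at h
  exact h

theorem lintegral_enorm_sq_le_average {w : (Fin n → ℝ) → ℂ} (hw : StronglyMeasurable w)
    {Q B : Set (Fin n → ℝ)} (hQ : MeasurableSet Q) (hQf : volume Q ≠ ⊤)
    (hint : ∀ y, IntegrableOn (fun h => w (y - h)) Q) {ε : ENNReal}
    (hε : ∀ h ∈ Q, ∫⁻ y, ‖w (y - h) - w y‖ₑ ^ 2 ≤ ε) :
    volume Q ^ 2 * ∫⁻ y in B, ‖w y‖ₑ ^ 2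
      ≤ 2 * (∫⁻ y in B, ‖∫ h in Q, w (y - h)‖ₑ ^ 2) + 2 * (volume Q ^ 2 * ε) := by
  have hsub : StronglyMeasurable (fun p : (Fin n → ℝ) × (Fin n → ℝ) => w (p.1 - p.2)) :=
    hw.comp_measurable (by fun_prop)
  have hdiff : StronglyMeasurable (fun p : (Fin n → ℝ) × (Fin n → ℝ) => w (p.1 - p.2) - w p.1) :=
    hsub.sub (hw.comp_measurable measurable_fst)
  have hD : ∀ y, StronglyMeasurable fun h => w (y - h) - w y := fun y =>
    hdiff.comp_measurable measurable_prodMk_left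
  have hpt : ∀ y, volume Q ^ 2 * ‖w y‖ₑ ^ 2 ≤ 2 * ‖∫ h in Q, w (y - h)‖ₑ ^ 2 +
      2 * (volume Q * ∫⁻ h in Q, ‖w (y - h) - w y‖ₑ ^ 2) := by
    intro y
    have h1 : volume Q * ‖w y‖ₑ ≤ ‖∫ h in Q, w (y - h)‖ₑ + ∫⁻ h in Q, ‖w (y - h) - w y‖ₑ := by
      have hc : IntegrableOn (fun _ : Fin n → ℝ => w y) Q := integrableOn_const hQf
      have e1 : ∫ h in Q, (w (y - h) - w y) = (∫ h in Q, w (y - h)) - ∫ h in Q, w y :=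
        integral_sub (hint y) hc
      have e2 : volume Q * ‖w y‖ₑ = ‖∫ h in Q, w y‖ₑ := by
        rw [setIntegral_const, enorm_smul, Measure.real, Real.enorm_eq_ofReal ENNReal.toReal_nonneg,
          ENNReal.ofReal_toReal hQf]
      have e3 : (∫ h in Q, w y) = (∫ h in Q, w (y - h)) - ∫ h in Q, (w (y - h) - w y) := by
        rw [e1]; ring
      rw [e2, e3]
      exact enorm_sub_le.trans (add_le_add le_rfl (enorm_integral_le_lintegral_enorm _))
    rw [← mul_pow]
    refine (pow_le_pow_left₀ zero_le h1 2).trans ((ennreal_add_sq_le _ _).trans ?_)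
    gcongr
    simpa using sq_lintegral_enorm_le (ν := volume.restrict Q) (hD y).aestronglyMeasurable
  have hm1 : Measurable fun y => ‖∫ h in Q, w (y - h)‖ₑ ^ 2 :=
    (hsub.integral_prod_right (ν := volume.restrict Q)).enorm.pow_const 2
  have hm2 : Measurable fun p : (Fin n → ℝ) × (Fin n → ℝ) => ‖w (p.1 - p.2) - w p.1‖ₑ ^ 2 :=
    hdiff.enorm.pow_const 2
  calc volume Q ^ 2 * ∫⁻ y in B, ‖w y‖ₑ ^ 2
      = ∫⁻ y in B, volume Q ^ 2 * ‖w y‖ₑ ^ 2 :=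
        (lintegral_const_mul _ (hw.enorm.pow_const 2)).symm
    _ ≤ ∫⁻ y in B, (2 * ‖∫ h in Q, w (y - h)‖ₑ ^ 2 +
          2 * (volume Q * ∫⁻ h in Q, ‖w (y - h) - w y‖ₑ ^ 2)) := lintegral_mono hpt
    _ = 2 * (∫⁻ y in B, ‖∫ h in Q, w (y - h)‖ₑ ^ 2) +
          2 * (volume Q * ∫⁻ y in B, ∫⁻ h in Q, ‖w (y - h) - w y‖ₑ ^ 2) := by
        have hm3 : Measurable fun y => ∫⁻ h in Q, ‖w (y - h) - w y‖ₑ ^ 2 :=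
          hm2.lintegral_prod_right' (ν := volume.restrict Q)
        rw [lintegral_add_left (hm1.const_mul 2), lintegral_const_mul _ hm1,
          lintegral_const_mul _ (hm3.const_mul _), lintegral_const_mul _ hm3]
    _ ≤ _ := by
        rw [sq, mul_assoc]
        gcongr
        calc ∫⁻ y in B, ∫⁻ h in Q, ‖w (y - h) - w y‖ₑ ^ 2
            = ∫⁻ h in Q, ∫⁻ y in B, ‖w (y - h) - w y‖ₑ ^ 2 :=
              lintegral_lintegral_swap hm2.aemeasurable
          _ ≤ ∫⁻ h in Q, ε := setLIntegral_mono' hQ fun h hh =>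
              (setLIntegral_le_lintegral _ _).trans (hε h hh)
          _ = volume Q * ε := by rw [setLIntegral_const, mul_comm]

/-- The linear functional `ξ ↦ -(2π)⁻¹ z·ξ`, as a linear function of `z`. -/
def scaledDot (n : ℕ) : (Fin n → ℝ) →ₗ[ℝ] StrongDual ℝ (Fin n → ℝ) :=
  (-(2 * Real.pi)⁻¹ : ℝ) • (LinearMap.toContinuousLinearMap.toLinearMap ∘ₗ dotProductBilin ℝ ℝ)

theorem scaledDot_apply (z ξ : Fin n → ℝ) :
    scaledDot n z ξ = -(2 * Real.pi)⁻¹ * (z ⬝ᵥ ξ) := by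
  simp [scaledDot, dotProductBilin]

theorem scaledDot_injective : Function.Injective (scaledDot n) := by
  rw [injective_iff_map_eq_zero]
  intro z hz
  have h : scaledDot n z z = 0 := by rw [hz]; rfl
  rw [scaledDot_apply] at h
  have : z ⬝ᵥ z = 0 := by
    rcases mul_eq_zero.1 h with h | h
    · exact absurd h (by simp [Real.pi_ne_zero])
    · exact h
  exact dotProduct_self_eq_zero.1 this

theorem tendsto_setIntegral_exp_dotProduct {Q : Set (Fin n → ℝ)} (hQ : MeasurableSet Q) :
    Tendsto (fun z : Fin n → ℝ => ∫ ξ in Q, Complex.exp (Complex.I * ((z ⬝ᵥ ξ : ℝ) : ℂ)))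
      (cocompact _) (𝓝 0) := by
  have h := (tendsto_integral_exp_smul_cocompact (Q.indicator fun _ => (1 : ℂ))
    (volume : Measure (Fin n → ℝ))).comp
    (LinearMap.isClosedEmbedding_of_injective
      (LinearMap.ker_eq_bot.2 (scaledDot_injective (n := n)))).tendsto_cocompact
  refine h.congr fun z => ?_
  rw [← integral_indicator hQ]
  refine integral_congr_ae (Eventually.of_forall fun ξ => ?_)
  by_cases hξ : ξ ∈ Q
  · simp only [Set.indicator_of_mem hξ, scaledDot_apply, Circle.smul_def,
      Real.fourierChar_apply, smul_eq_mul, mul_one]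
    congr 1
    push_cast
    field_simp
  · simp [Set.indicator_of_notMem hξ]

theorem enorm_exp_sub_one_sq (t : ℝ) :
    ‖Complex.exp (Complex.I * (t : ℂ)) - 1‖ₑ ^ 2
      = ENNReal.ofReal (2 - 2 * (Complex.exp (Complex.I * (t : ℂ))).re) := by
  rw [← ofReal_norm, ← ENNReal.ofReal_pow (norm_nonneg _), ← Complex.normSq_eq_norm_sq,
    Complex.normSq_sub, Complex.normSq_eq_norm_sq, mul_comm Complex.I, Complex.norm_exp_ofReal_mul_I]
  simp
  norm_num

theorem exists_isCompact_lintegral_compl_le {Q : Set (Fin n → ℝ)} (hQ : MeasurableSet Q)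
    (hQ0 : volume Q ≠ 0) (hQf : volume Q ≠ ⊤) :
    ∃ B : Set (Fin n → ℝ), IsCompact B ∧ ∀ (w : (Fin n → ℝ) → ℂ) (_ : StronglyMeasurable w)
      (ε : ENNReal), (∀ ξ ∈ Q, ∫⁻ z,
        ‖Complex.exp (Complex.I * ((z ⬝ᵥ ξ : ℝ) : ℂ)) * w z - w z‖ₑ ^ 2 ≤ ε) →
      ∫⁻ z in Bᶜ, ‖w z‖ₑ ^ 2 ≤ ε := by
  have hm : 0 < volume.real Q := ENNReal.toReal_pos hQ0 hQf
  have h := (tendsto_setIntegral_exp_dotProduct hQ).norm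
  rw [norm_zero] at h
  obtain ⟨B, hB, hBs⟩ := mem_cocompact.1 (h (Iio_mem_nhds (half_pos hm)))
  refine ⟨B, hB, fun w hw ε hε => ?_⟩
  have hpt : ∀ z ∈ Bᶜ, volume Q ≤
      ∫⁻ ξ in Q, ‖Complex.exp (Complex.I * ((z ⬝ᵥ ξ : ℝ) : ℂ)) - 1‖ₑ ^ 2 := by
    intro z hz
    have hz' : ‖∫ ξ in Q, Complex.exp (Complex.I * ((z ⬝ᵥ ξ : ℝ) : ℂ))‖ < volume.real Q / 2 :=
      hBs hz
    have hcont : Continuous fun ξ : Fin n → ℝ => Complex.exp (Complex.I * ((z ⬝ᵥ ξ : ℝ) : ℂ)) := by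
      fun_prop
    have hbd : ∀ ξ : Fin n → ℝ, ‖Complex.exp (Complex.I * ((z ⬝ᵥ ξ : ℝ) : ℂ))‖ = 1 := fun ξ => by
      rw [mul_comm, Complex.norm_exp_ofReal_mul_I]
    have hi : IntegrableOn (fun ξ : Fin n → ℝ =>
        Complex.exp (Complex.I * ((z ⬝ᵥ ξ : ℝ) : ℂ))) Q :=
      Integrable.mono' (g := fun _ => (1 : ℝ)) (integrableOn_const hQf)
        hcont.aestronglyMeasurable (Eventually.of_forall fun ξ => (hbd ξ).le)
    have hir : IntegrableOn (fun ξ : Fin n → ℝ =>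
        (Complex.exp (Complex.I * ((z ⬝ᵥ ξ : ℝ) : ℂ))).re) Q := hi.re
    simp_rw [enorm_exp_sub_one_sq]
    have hI : IntegrableOn (fun ξ : Fin n → ℝ =>
        2 - 2 * (Complex.exp (Complex.I * ((z ⬝ᵥ ξ : ℝ) : ℂ))).re) Q :=
      Integrable.sub (integrableOn_const hQf) (hir.const_mul 2)
    rw [← ofReal_integral_eq_lintegral_ofReal hI (Eventually.of_forall fun ξ => ?_)]
    · rw [integral_sub (integrableOn_const (C := (2 : ℝ)) hQf) (hir.const_mul 2), setIntegral_const,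
        integral_const_mul]
      have hre : ∫ ξ in Q, (Complex.exp (Complex.I * ((z ⬝ᵥ ξ : ℝ) : ℂ))).re
          = (∫ ξ in Q, Complex.exp (Complex.I * ((z ⬝ᵥ ξ : ℝ) : ℂ))).re := integral_re hi
      rw [hre, ← ENNReal.ofReal_toReal hQf]
      apply ENNReal.ofReal_le_ofReal
      have := Complex.re_le_norm (∫ ξ in Q, Complex.exp (Complex.I * ((z ⬝ᵥ ξ : ℝ) : ℂ)))
      change volume.real Q ≤ _
      rw [smul_eq_mul]
      linarith
    · have := Complex.re_le_norm (Complex.exp (Complex.I * ((z ⬝ᵥ ξ : ℝ) : ℂ)))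
      rw [hbd ξ] at this
      simp only [Pi.zero_apply]
      linarith
  have hmeas : Measurable fun p : (Fin n → ℝ) × (Fin n → ℝ) =>
      ‖Complex.exp (Complex.I * ((p.1 ⬝ᵥ p.2 : ℝ) : ℂ)) * w p.1 - w p.1‖ₑ ^ 2 := by
    have hc : Continuous fun p : (Fin n → ℝ) × (Fin n → ℝ) =>
      Complex.exp (Complex.I * ((p.1 ⬝ᵥ p.2 : ℝ) : ℂ)) := by fun_prop
    have hw1 := hw.comp_measurable
      (measurable_fst : Measurable (Prod.fst : (Fin n → ℝ) × (Fin n → ℝ) → (Fin n → ℝ)))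
    exact (((hc.stronglyMeasurable.mul hw1).sub hw1).enorm).pow_const 2
  have key : volume Q * ∫⁻ z in Bᶜ, ‖w z‖ₑ ^ 2 ≤ volume Q * ε :=
    calc volume Q * ∫⁻ z in Bᶜ, ‖w z‖ₑ ^ 2
        = ∫⁻ z in Bᶜ, volume Q * ‖w z‖ₑ ^ 2 :=
          (lintegral_const_mul _ (hw.enorm.pow_const 2)).symm
      _ ≤ ∫⁻ z in Bᶜ, ∫⁻ ξ in Q,
            ‖Complex.exp (Complex.I * ((z ⬝ᵥ ξ : ℝ) : ℂ)) * w z - w z‖ₑ ^ 2 := by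
          refine setLIntegral_mono' hB.measurableSet.compl fun z hz => ?_
          have e : ∀ ξ : Fin n → ℝ,
              ‖Complex.exp (Complex.I * ((z ⬝ᵥ ξ : ℝ) : ℂ)) * w z - w z‖ₑ ^ 2
              = ‖Complex.exp (Complex.I * ((z ⬝ᵥ ξ : ℝ) : ℂ)) - 1‖ₑ ^ 2 * ‖w z‖ₑ ^ 2 := fun ξ => by
            rw [← mul_pow, ← enorm_mul, sub_mul, one_mul]
          simp_rw [e]
          rw [lintegral_mul_const _ (by fun_prop)]
          gcongr
          exact hpt z hz
      _ = ∫⁻ ξ in Q, ∫⁻ z in Bᶜ,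
            ‖Complex.exp (Complex.I * ((z ⬝ᵥ ξ : ℝ) : ℂ)) * w z - w z‖ₑ ^ 2 :=
          lintegral_lintegral_swap hmeas.aemeasurable
      _ ≤ ∫⁻ ξ in Q, ε := setLIntegral_mono' hQ fun ξ hξ =>
          (setLIntegral_le_lintegral _ _).trans (hε ξ hξ)
      _ = volume Q * ε := by rw [setLIntegral_const, mul_comm]
  exact (ENNReal.mul_le_mul_iff_right hQ0 hQf).1 key

end Averaging

section WeakConvergence

theorem exists_weakly_convergent_subseq {E : Type*} [NormedAddCommGroup E] [InnerProductSpace ℂ E]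
    [CompleteSpace E] [TopologicalSpace.SeparableSpace E] {v : ℕ → E} {C : ℝ}
    (hv : ∀ k, ‖v k‖ ≤ C) :
    ∃ a : E, ∃ φ : ℕ → ℕ, StrictMono φ ∧
      ∀ f : E, Tendsto (fun k => inner ℂ f (v (φ k))) atTop (𝓝 (inner ℂ f a)) := by
  obtain ⟨a, -, φ, hφ, ha⟩ := WeakDual.isSeqCompact_closedBall ℂ E (0 : StrongDual ℂ E) C
    (x := fun k => StrongDual.toWeakDual (InnerProductSpace.toDual ℂ E (v k))) (fun k => by
      change InnerProductSpace.toDual ℂ E (v k) ∈ Metric.closedBall 0 C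
      simpa using hv k)
  refine ⟨(InnerProductSpace.toDual ℂ E).symm (WeakDual.toStrongDual a), φ, hφ, fun f => ?_⟩
  have h := ((WeakDual.eval_continuous f).tendsto a).comp ha
  have h' := (Complex.continuous_conj.tendsto _).comp h
  rw [← inner_conj_symm, InnerProductSpace.toDual_symm_apply]
  refine h'.congr fun k => ?_
  rw [← inner_conj_symm]
  rfl

end WeakConvergence

section Compactness

variable {n : ℕ} {W : Xi n → (Hn n →L[ℂ] Hn n)}

theorem IsWeylFamily.translation (hW : IsWeylFamily n W) (x : Fin n → ℝ) (u : Hn n) :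
    ∀ᵐ y, W (x, 0) u y = u (y - x) := by
  filter_upwards [hW x 0 u] with y hy
  simpa using hy

theorem IsWeylFamily.modulation (hW : IsWeylFamily n W) (ξ : Fin n → ℝ) (u : Hn n) :
    ∀ᵐ y, W (0, ξ) u y = Complex.exp (Complex.I * ((y ⬝ᵥ ξ : ℝ) : ℂ)) * u y := by
  filter_upwards [hW 0 ξ u] with y hy
  simpa using hy

theorem IsWeylFamily.enorm_translation_sub_sq (hW : IsWeylFamily n W) (x : Fin n → ℝ) (u : Hn n) :
    ‖W (x, 0) u - u‖ₑ ^ 2 = ∫⁻ y, ‖u (y - x) - u y‖ₑ ^ 2 := by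
  rw [Lp_enorm_sq]
  refine lintegral_congr_ae ?_
  filter_upwards [Lp.coeFn_sub (W (x, 0) u) u, hW.translation x u] with y h1 h2
  rw [h1, Pi.sub_apply, h2]

theorem IsWeylFamily.enorm_modulation_sub_sq (hW : IsWeylFamily n W) (ξ : Fin n → ℝ) (u : Hn n) :
    ‖W (0, ξ) u - u‖ₑ ^ 2
      = ∫⁻ y, ‖Complex.exp (Complex.I * ((y ⬝ᵥ ξ : ℝ) : ℂ)) * u y - u y‖ₑ ^ 2 := by
  rw [Lp_enorm_sq]
  refine lintegral_congr_ae ?_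
  filter_upwards [Lp.coeFn_sub (W (0, ξ) u) u, hW.modulation ξ u] with y h1 h2
  rw [h1, Pi.sub_apply, h2]

theorem preimage_sub_left_closedBall {E : Type*} [SeminormedAddCommGroup E] (y : E) (δ : ℝ) :
    (fun h => y - h) ⁻¹' Metric.closedBall y δ = Metric.closedBall 0 δ := by
  ext h
  simp [dist_eq_norm]

theorem integrableOn_sub_left_closedBall (w : Hn n) (y : Fin n → ℝ) (δ : ℝ) :
    IntegrableOn (fun h => w (y - h)) (Metric.closedBall 0 δ) := by
  rw [← preimage_sub_left_closedBall y δ]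
  exact ((Measure.measurePreserving_sub_left volume y).integrableOn_comp_preimage
    (Homeomorph.subLeft y).measurableEmbedding).2
    (integrableOn_Lp_of_measure_ne_top w (by norm_num) measure_closedBall_lt_top.ne)

theorem setIntegral_sub_left_closedBall (w : Hn n) (y : Fin n → ℝ) (δ : ℝ) :
    ∫ h in Metric.closedBall 0 δ, w (y - h) =
      inner ℂ (indicatorConstLp 2 (Metric.isClosed_closedBall (x := y) (ε := δ)).measurableSet
        measure_closedBall_lt_top.ne (1 : ℂ)) w := by
  rw [L2.inner_indicatorConstLp_one, ← preimage_sub_left_closedBall y δ]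
  exact (Measure.measurePreserving_sub_left volume y).setIntegral_preimage_emb
    (Homeomorph.subLeft y).measurableEmbedding w _

theorem tendsto_lintegral_setIntegral_sub_left {ι : Type*} {l : Filter ι} [l.IsCountablyGenerated]
    {w : ι → Hn n} {C : ℝ} (hC : ∀ i, ‖w i‖ ≤ C)
    (hweak : ∀ f : Hn n, Tendsto (fun i => inner ℂ f (w i)) l (𝓝 0))
    {B : Set (Fin n → ℝ)} (hB : IsCompact B) (δ : ℝ) :
    Tendsto (fun i => ∫⁻ y in B, ‖∫ h in Metric.closedBall 0 δ, w i (y - h)‖ₑ ^ 2) l (𝓝 0) := by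
  set V : ℝ := (volume : Measure (Fin n → ℝ)).real (Metric.closedBall 0 δ) with hV
  have h := tendsto_lintegral_filter_of_dominated_convergence (μ := volume.restrict B) (l := l)
    (F := fun i y => ‖∫ h in Metric.closedBall 0 δ, w i (y - h)‖ₑ ^ 2) (f := fun _ => 0)
    (fun _ => ENNReal.ofReal (V ^ (1 / 2 : ℝ) * C) ^ 2) ?_ ?_ ?_ ?_
  · simpa using h
  · refine Eventually.of_forall fun i => ?_
    have hsub : StronglyMeasurable (fun p : (Fin n → ℝ) × (Fin n → ℝ) => w i (p.1 - p.2)) :=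
      (Lp.stronglyMeasurable (w i)).comp_measurable (by fun_prop)
    exact (hsub.integral_prod_right
      (ν := volume.restrict (Metric.closedBall 0 δ))).enorm.pow_const 2
  · refine Eventually.of_forall fun i => Eventually.of_forall fun y => ?_
    gcongr
    rw [← ofReal_norm]
    apply ENNReal.ofReal_le_ofReal
    rw [setIntegral_sub_left_closedBall]
    refine (norm_inner_le_norm _ _).trans ?_
    rw [norm_indicatorConstLp (by norm_num) (by norm_num)]
    have : (volume : Measure (Fin n → ℝ)).real (Metric.closedBall y δ) = V := by
      rw [hV, Measure.real, Measure.real, Measure.addHaar_closedBall_center]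
    rw [this]
    simp only [norm_one, one_mul, ENNReal.toReal_ofNat]
    gcongr
    exact hC i
  · rw [setLIntegral_const]
    exact ENNReal.mul_ne_top (by simp) hB.measure_lt_top.ne
  · refine Eventually.of_forall fun y => ?_
    simp_rw [setIntegral_sub_left_closedBall]
    have := ENNReal.Tendsto.pow (n := 2) (hweak (indicatorConstLp 2
      (Metric.isClosed_closedBall (x := y) (ε := δ)).measurableSet
      measure_closedBall_lt_top.ne (1 : ℂ))).enorm
    simpa using this

theorem IsWeylFamily.tendsto_zero_of_weak (hW : IsWeylFamily n W) {ι : Type*} {l : Filter ι}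
    [l.IsCountablyGenerated] {w : ι → Hn n} {C : ℝ} (hC : ∀ i, ‖w i‖ ≤ C)
    (hweak : ∀ f : Hn n, Tendsto (fun i => inner ℂ f (w i)) l (𝓝 0))
    (htrans : ∀ ε > 0, ∃ δ > 0, ∀ x, ‖x‖ ≤ δ → ∀ i, ‖W (x, 0) (w i) - w i‖ ≤ ε)
    (hmod : ∀ ε > 0, ∃ δ > 0, ∀ ξ, ‖ξ‖ ≤ δ → ∀ i, ‖W (0, ξ) (w i) - w i‖ ≤ ε) :
    Tendsto w l (𝓝 0) := by
  rw [NormedAddGroup.tendsto_nhds_zero]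
  intro ε hε
  set η : ℝ := ε / 4 with hηdef
  have hη : 0 < η := by positivity
  obtain ⟨δ₁, hδ₁, h₁⟩ := htrans η hη
  obtain ⟨δ₂, hδ₂, h₂⟩ := hmod η hη
  have hpos : ∀ {δ : ℝ}, 0 < δ →
      (volume : Measure (Fin n → ℝ)) (Metric.closedBall 0 δ) ≠ 0 := fun hδ =>
    (Metric.measure_closedBall_pos volume 0 hδ).ne'
  have hsq : ∀ {v : Hn n} {r : ℝ}, ‖v‖ ≤ r → ‖v‖ₑ ^ 2 ≤ ENNReal.ofReal r ^ 2 := fun hv => by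
    rw [← ofReal_norm]
    gcongr
  obtain ⟨B, hB, htail⟩ := exists_isCompact_lintegral_compl_le
    (Metric.isClosed_closedBall (x := (0 : Fin n → ℝ)) (ε := δ₂)).measurableSet (hpos hδ₂)
    measure_closedBall_lt_top.ne
  set m := (volume : Measure (Fin n → ℝ)) (Metric.closedBall 0 δ₁) with hm
  have hm0 : m ^ 2 ≠ 0 := pow_ne_zero 2 (hpos hδ₁)
  have hmf : m ^ 2 ≠ ⊤ := ENNReal.pow_ne_top measure_closedBall_lt_top.ne
  have hJ := tendsto_lintegral_setIntegral_sub_left hC hweak hB δ₁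
  have hpos' : 0 < m ^ 2 * ENNReal.ofReal η ^ 2 :=
    (mul_ne_zero hm0 (pow_ne_zero 2 (ENNReal.ofReal_pos.2 hη).ne')).bot_lt
  filter_upwards [hJ (Iio_mem_nhds hpos')] with i hi
  have htail_i : ∫⁻ y in Bᶜ, ‖w i y‖ₑ ^ 2 ≤ ENNReal.ofReal η ^ 2 :=
    htail _ (Lp.stronglyMeasurable (w i)) _ fun ξ hξ => by
      rw [← hW.enorm_modulation_sub_sq]
      exact hsq (h₂ ξ (by simpa using hξ) i)
  have hloc : m ^ 2 * ∫⁻ y in B, ‖w i y‖ₑ ^ 2 ≤ m ^ 2 * (4 * ENNReal.ofReal η ^ 2) := by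
    refine (lintegral_enorm_sq_le_average (B := B) (Lp.stronglyMeasurable (w i))
      (Metric.isClosed_closedBall (x := (0 : Fin n → ℝ)) (ε := δ₁)).measurableSet
      measure_closedBall_lt_top.ne
      (fun y => integrableOn_sub_left_closedBall (w i) y δ₁) (ε := ENNReal.ofReal η ^ 2)
      fun h hh => ?_).trans ?_
    · rw [← hW.enorm_translation_sub_sq]
      exact hsq (h₁ h (by simpa using hh) i)
    · calc _ ≤ 2 * (m ^ 2 * ENNReal.ofReal η ^ 2) + 2 * (m ^ 2 * ENNReal.ofReal η ^ 2) := by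
            gcongr
            exact le_of_lt hi
        _ = _ := by ring
  have hloc' := (ENNReal.mul_le_mul_iff_right hm0 hmf).1 hloc
  have htot : ‖w i‖ₑ ^ 2 ≤ ENNReal.ofReal (3 * η) ^ 2 := by
    rw [Lp_enorm_sq, ← lintegral_add_compl _ hB.measurableSet]
    calc _ ≤ 4 * ENNReal.ofReal η ^ 2 + ENNReal.ofReal η ^ 2 := add_le_add hloc' htail_i
      _ = 5 * ENNReal.ofReal η ^ 2 := by ring
      _ ≤ 9 * ENNReal.ofReal η ^ 2 := by gcongr; norm_num
      _ = _ := by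
        rw [ENNReal.ofReal_mul (by norm_num), mul_pow]
        norm_num
  have h3 : ‖w i‖ ≤ 3 * η := by
    rw [← ofReal_norm, ENNReal.pow_le_pow_left_iff two_ne_zero,
      ENNReal.ofReal_le_ofReal_iff (by positivity)] at htot
    exact htot
  rw [hηdef] at h3
  linarith

/-- A Kolmogorov–Riesz criterion: a closed bounded set on which small translations and small
modulations act uniformly close to the identity is compact. -/
theorem IsWeylFamily.isCompact_of_equicontinuous (hW : IsWeylFamily n W) {K : Set (Hn n)}
    (hK : IsClosed K) {C : ℝ} (hC : ∀ v ∈ K, ‖v‖ ≤ C)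
    (htrans : ∀ ε > 0, ∃ δ > 0, ∀ x, ‖x‖ ≤ δ → ∀ v ∈ K, ‖W (x, 0) v - v‖ ≤ ε)
    (hmod : ∀ ε > 0, ∃ δ > 0, ∀ ξ, ‖ξ‖ ≤ δ → ∀ v ∈ K, ‖W (0, ξ) v - v‖ ≤ ε) :
    IsCompact K := by
  refine IsSeqCompact.isCompact fun v hv => ?_
  have : Fact ((2 : ENNReal) ≠ ⊤) := ⟨by norm_num⟩
  obtain ⟨a, φ, hφ, ha⟩ := exists_weakly_convergent_subseq fun k => hC _ (hv k)
  have hdouble : ∀ {Y : Xi n} {r : ℝ}, (∀ v ∈ K, ‖W Y v - v‖ ≤ r / 2) → ∀ p : ℕ × ℕ,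
      ‖W Y (v (φ p.1) - v (φ p.2)) - (v (φ p.1) - v (φ p.2))‖ ≤ r := fun {Y r} h p => by
    rw [map_sub, sub_sub_sub_comm]
    have e1 := h _ (hv (φ p.1))
    have e2 := h _ (hv (φ p.2))
    exact (norm_sub_le _ _).trans (by linarith)
  have hzero : Tendsto (fun p : ℕ × ℕ => v (φ p.1) - v (φ p.2)) atTop (𝓝 0) := by
    refine hW.tendsto_zero_of_weak (C := C + C) (fun p => ?_) (fun f => ?_) (fun ε hε => ?_)
      (fun ε hε => ?_)
    · exact (norm_sub_le _ _).trans (add_le_add (hC _ (hv _)) (hC _ (hv _)))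
    · simp_rw [inner_sub_right]
      rw [← prod_atTop_atTop_eq, ← sub_self (inner ℂ f a)]
      exact ((ha f).comp tendsto_fst).sub ((ha f).comp tendsto_snd)
    · obtain ⟨δ, hδ, h⟩ := htrans (ε / 2) (half_pos hε)
      exact ⟨δ, hδ, fun x hx => hdouble (h x hx)⟩
    · obtain ⟨δ, hδ, h⟩ := hmod (ε / 2) (half_pos hε)
      exact ⟨δ, hδ, fun x hx => hdouble (h x hx)⟩
  have hcauchy : CauchySeq (v ∘ φ) := by
    rw [cauchySeq_iff_tendsto_dist_atTop_0]
    simpa [dist_eq_norm] using hzero.norm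
  obtain ⟨b, hb⟩ := cauchySeq_tendsto_of_complete hcauchy
  exact ⟨b, hK.mem_of_tendsto hb (Eventually.of_forall fun k => hv _), φ, hφ, hb⟩

end Compactness

section Orbit

variable {n : ℕ} {W : Xi n → (Hn n →L[ℂ] Hn n)}

theorem IsWeylFamily.tendsto_translation (hW : IsWeylFamily n W) (u : Hn n) :
    Tendsto (fun x : Fin n → ℝ => W (x, 0) u) (𝓝 0) (𝓝 u) := by
  let g : C((Fin n → ℝ), C((Fin n → ℝ), (Fin n → ℝ))) :=
    (ContinuousMap.mk (fun p : (Fin n → ℝ) × (Fin n → ℝ) => p.2 - p.1) (by fun_prop)).curry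
  have hg : ∀ x, MeasurePreserving (g x) volume volume := fun x =>
    measurePreserving_sub_right volume x
  have hc : Continuous fun x => Lp.compMeasurePreserving (g x) (hg x) u :=
    continuous_const.compMeasurePreservingLp g.continuous hg (by norm_num)
  have he : ∀ x, Lp.compMeasurePreserving (g x) (hg x) u = W (x, 0) u := fun x => by
    apply Lp.ext
    filter_upwards [Lp.coeFn_compMeasurePreserving u (hg x), hW.translation x u] with y h1 h2
    rw [h1, h2]
    rfl
  have h0 : W (0, 0) u = u := by
    apply Lp.ext
    filter_upwards [hW.translation 0 u] with y h
    rw [h, sub_zero]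
  simp_rw [he] at hc
  simpa only [h0] using hc.tendsto 0

theorem IsWeylFamily.tendsto_modulation (hW : IsWeylFamily n W) (u : Hn n) :
    Tendsto (fun ξ : Fin n → ℝ => W (0, ξ) u) (𝓝 0) (𝓝 u) := by
  have hu : Measurable fun y => ‖u y‖ₑ := (Lp.stronglyMeasurable u).enorm
  have h : Tendsto (fun ξ : Fin n → ℝ => ‖W (0, ξ) u - u‖ₑ ^ 2) (𝓝 0) (𝓝 0) := by
    simp_rw [hW.enorm_modulation_sub_sq]
    have := tendsto_lintegral_filter_of_dominated_convergence (l := 𝓝 (0 : Fin n → ℝ))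
      (μ := (volume : Measure (Fin n → ℝ)))
      (F := fun ξ y => ‖Complex.exp (Complex.I * ((y ⬝ᵥ ξ : ℝ) : ℂ)) * u y - u y‖ₑ ^ 2)
      (f := fun _ => 0) (fun y => 4 * ‖u y‖ₑ ^ 2) ?_ ?_ ?_ ?_
    · simpa using this
    · refine Eventually.of_forall fun ξ => ?_
      have hc : Continuous fun y : Fin n → ℝ => Complex.exp (Complex.I * ((y ⬝ᵥ ξ : ℝ) : ℂ)) := by
        fun_prop
      exact ((hc.stronglyMeasurable.mul (Lp.stronglyMeasurable u)).sub
        (Lp.stronglyMeasurable u)).enorm.pow_const 2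
    · refine Eventually.of_forall fun ξ => Eventually.of_forall fun y => ?_
      have h1 : ‖Complex.exp (Complex.I * ((y ⬝ᵥ ξ : ℝ) : ℂ)) * u y‖ₑ = ‖u y‖ₑ := by
        rw [enorm_mul, ← ofReal_norm (Complex.exp _), mul_comm Complex.I,
          Complex.norm_exp_ofReal_mul_I]
        simp
      have h2 := enorm_sub_le (a := Complex.exp (Complex.I * ((y ⬝ᵥ ξ : ℝ) : ℂ)) * u y) (b := u y)
      rw [h1, ← two_mul] at h2
      refine (pow_le_pow_left₀ zero_le h2 2).trans (le_of_eq ?_)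
      rw [mul_pow]
      norm_num
    · rw [lintegral_const_mul _ (hu.pow_const 2), ← Lp_enorm_sq]
      exact ENNReal.mul_ne_top (by norm_num) (ENNReal.pow_ne_top enorm_ne_top)
    · refine Eventually.of_forall fun y => ?_
      have hc : Continuous fun ξ : Fin n → ℝ =>
          ‖Complex.exp (Complex.I * ((y ⬝ᵥ ξ : ℝ) : ℂ)) * u y - u y‖ₑ ^ 2 := by
        fun_prop
      simpa using hc.tendsto 0
  rw [tendsto_iff_edist_tendsto_0]
  simp_rw [edist_eq_enorm_sub]
  have h' := h.ennrpow_const (1 / 2 : ℝ)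
  simp_rw [← ENNReal.rpow_natCast, ← ENNReal.rpow_mul] at h'
  simpa using h'

theorem IsWeylFamily.map_zero (hW : IsWeylFamily n W) : W 0 = 1 := by
  ext1 u
  apply Lp.ext
  filter_upwards [hW.translation 0 u] with y h
  rw [sub_zero] at h
  exact h

/-- The Weyl operators commute up to a phase. -/
theorem IsWeylFamily.exists_commutation (hW : IsWeylFamily n W) (X Y : Xi n) :
    ∃ c : ℂ, c * star c = 1 ∧ W Y * W X = c • (W X * W Y) := by
  obtain ⟨x, ξ⟩ := X
  obtain ⟨z, ζ⟩ := Y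
  set t : ℝ := x ⬝ᵥ ζ - z ⬝ᵥ ξ
  refine ⟨Complex.exp (Complex.I * (t : ℂ)), ?_, ?_⟩
  · rw [Complex.star_def, Complex.mul_conj, Complex.normSq_eq_norm_sq, mul_comm,
      Complex.norm_exp_ofReal_mul_I]
    simp
  ext1 u
  apply Lp.ext
  have hx :=
    (measurePreserving_sub_right (volume : Measure (Fin n → ℝ)) z).quasiMeasurePreserving.ae
      (hW x ξ u)
  have hz :=
    (measurePreserving_sub_right (volume : Measure (Fin n → ℝ)) x).quasiMeasurePreserving.ae
      (hW z ζ u)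
  filter_upwards [hx, hz, hW z ζ (W (x, ξ) u), hW x ξ (W (z, ζ) u),
    Lp.coeFn_smul (Complex.exp (Complex.I * (t : ℂ))) (W (x, ξ) (W (z, ζ) u))] with y h1 h2 h3 h4 h5
  change W (z, ζ) (W (x, ξ) u) y
    = (Complex.exp (Complex.I * (t : ℂ)) • W (x, ξ) (W (z, ζ) u) : Hn n) y
  rw [h5, Pi.smul_apply, h3, h4, h1, h2, smul_eq_mul, ← mul_assoc, ← mul_assoc, ← mul_assoc,
    ← Complex.exp_add, ← Complex.exp_add, ← Complex.exp_add, sub_right_comm y z x]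
  congr 2
  simp only [t, sub_dotProduct, smul_dotProduct, smul_eq_mul]
  push_cast
  ring

theorem IsWeylFamily.Tconj_comm (hW : IsWeylFamily n W) (X Y : Xi n) (S : Hn n →L[ℂ] Hn n) :
    Tconj n W Y (Tconj n W X S) = Tconj n W X (Tconj n W Y S) := by
  obtain ⟨c, hc, h⟩ := hW.exists_commutation X Y
  have e : ∀ A B : Hn n →L[ℂ] Hn n, A * (B * S * star B) * star A = A * B * S * star (A * B) :=
    fun A B => by simp only [star_mul, mul_assoc]
  simp only [Tconj]
  rw [e, e, h, star_smul, smul_mul_assoc, smul_mul_assoc, mul_smul_comm, smul_smul, hc, one_smul]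

theorem norm_Tconj (hWU : ∀ X : Xi n, W X ∈ unitary (Hn n →L[ℂ] Hn n)) (X : Xi n)
    (S : Hn n →L[ℂ] Hn n) : ‖Tconj n W X S‖ = ‖S‖ := by
  rw [Tconj, CStarRing.norm_mul_mem_unitary _ (Unitary.star_mem (hWU X)),
    CStarRing.norm_mem_unitary_mul _ (hWU X)]

theorem IsWeylFamily.norm_sub_Tconj_apply_le (hW : IsWeylFamily n W)
    (hWU : ∀ X : Xi n, W X ∈ unitary (Hn n →L[ℂ] Hn n)) (S : Hn n →L[ℂ] Hn n) (u : Hn n)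
    (X Y : Xi n) :
    ‖W Y (Tconj n W X S u) - Tconj n W X S u‖
      ≤ ‖Tconj n W Y S - S‖ * ‖W Y u‖ + ‖S‖ * ‖W Y u - u‖ := by
  have h1 : W Y (Tconj n W X S u) = Tconj n W X (Tconj n W Y S) (W Y u) := by
    rw [← hW.Tconj_comm]
    have hs : star (W Y) (W Y u) = u := by
      change (star (W Y) * W Y) u = u
      rw [Unitary.star_mul_self_of_mem (hWU Y)]
      rfl
    change _ = W Y (Tconj n W X S (star (W Y) (W Y u)))
    rw [hs]
  have h2 : Tconj n W X (Tconj n W Y S) (W Y u) - Tconj n W X S u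
      = Tconj n W X (Tconj n W Y S - S) (W Y u) + Tconj n W X S (W Y u - u) := by
    simp only [Tconj, mul_sub, sub_mul, _root_.sub_apply, map_sub]
    abel
  rw [h1, h2]
  refine (norm_add_le _ _).trans (add_le_add ?_ ?_)
  · refine (ContinuousLinearMap.le_opNorm _ _).trans ?_
    rw [norm_Tconj hWU]
  · refine (ContinuousLinearMap.le_opNorm _ _).trans ?_
    rw [norm_Tconj hWU]

/-- A path of Weyl operators converging strongly to the identity at `0` acts uniformly close to
the identity on the closure of the orbit. -/
theorem IsWeylFamily.exists_norm_sub_le_of_tendsto (hW : IsWeylFamily n W)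
    (hWU : ∀ X : Xi n, W X ∈ unitary (Hn n →L[ℂ] Hn n)) {S : Hn n →L[ℂ] Hn n} (hS : S ∈ B0 n W)
    (u : Hn n) {j : (Fin n → ℝ) → Xi n} (hj : Continuous j) (hj0 : j 0 = 0)
    (hu : Tendsto (fun x => W (j x) u) (𝓝 0) (𝓝 u)) {ε : ℝ} (hε : 0 < ε) :
    ∃ δ > 0, ∀ x, ‖x‖ ≤ δ → ∀ v ∈ closure (Set.range fun X : Xi n => Tconj n W X S u),
      ‖W (j x) v - v‖ ≤ ε := by
  have hS0 : Tendsto (fun x => Tconj n W (j x) S) (𝓝 0) (𝓝 S) := by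
    have h := (Continuous.comp hS hj).tendsto 0
    simpa [hj0, Tconj, hW.map_zero, Function.comp_def] using h
  have hlim : Tendsto (fun x => ‖Tconj n W (j x) S - S‖ * ‖W (j x) u‖ + ‖S‖ * ‖W (j x) u - u‖)
      (𝓝 0) (𝓝 0) := by
    have h := ((hS0.sub_const S).norm.mul hu.norm).add ((hu.sub_const u).norm.const_mul ‖S‖)
    simpa using h
  obtain ⟨δ, hδ, hball⟩ := Metric.nhds_basis_closedBall.mem_iff.1 (hlim (Iio_mem_nhds hε))
  refine ⟨δ, hδ, fun x hx => ?_⟩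
  refine closure_minimal ?_ (isClosed_le (by fun_prop) continuous_const :
    IsClosed {v : Hn n | ‖W (j x) v - v‖ ≤ ε})
  rintro _ ⟨X, rfl⟩
  have hx' : _ < ε := hball (mem_closedBall_zero_iff.2 hx)
  exact (hW.norm_sub_Tconj_apply_le hWU S u X (j x)).trans hx'.le

end Orbit

/-- for `S ∈ B⁰(H)` and `u ∈ H`, the orbit `{T_X(S)u : X ∈ Ξ}` is
relatively compact in `L²(ℝⁿ, ℂ)`. -/
theorem statement4 (n : ℕ) (W : Xi n → (Hn n →L[ℂ] Hn n))
    (hW : IsWeylFamily n W) (hWU : ∀ X : Xi n, W X ∈ unitary (Hn n →L[ℂ] Hn n))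
    (S : Hn n →L[ℂ] Hn n) (hS : S ∈ B0 n W) (u : Hn n) :
    IsCompact (closure (Set.range fun X : Xi n => Tconj n W X S u)) := by
  have hbd : ∀ v ∈ closure (Set.range fun X : Xi n => Tconj n W X S u), ‖v‖ ≤ ‖S‖ * ‖u‖ := by
    refine closure_minimal ?_ (isClosed_le continuous_norm continuous_const)
    rintro _ ⟨X, rfl⟩
    exact (ContinuousLinearMap.le_opNorm _ _).trans_eq (by rw [norm_Tconj hWU])
  exact hW.isCompact_of_equicontinuous isClosed_closure hbd
    (fun ε hε => hW.exists_norm_sub_le_of_tendsto hWU hS u (j := fun x => (x, 0)) (by fun_prop) rfl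
      (hW.tendsto_translation u) hε)
    (fun ε hε => hW.exists_norm_sub_le_of_tendsto hWU hS u (j := fun ξ => (0, ξ)) (by fun_prop) rfl
      (hW.tendsto_modulation u) hε)
end
end

section
/- An operator S ∈ B⁰(H) is compact if and only if T_X(S) converges to 0 in the *-strong operator topology along the cocompact (Fréchet) filter on ℝⁿ × ℝⁿ; that is, S is compact iff for every u ∈ H both ‖T_X(S) u‖ → 0 and ‖T_X(S)* u‖ → 0 as X → ∞ (along the filter of complements of relatively compact subsets of ℝⁿ × ℝⁿ). -/
open MeasureTheory Filter Topology Matrix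
open scoped Pointwise

noncomputable section

section HilbertSpace

variable {H : Type*} [NormedAddCommGroup H] [InnerProductSpace ℂ H]

theorem HilbertBasis.norm_eq_of_norm_inner_eq {ι : Type*} (b : HilbertBasis ι ℂ H) {x y : H}
    (h : ∀ m, ‖inner ℂ (b m) x‖ = ‖inner ℂ (b m) y‖) : ‖x‖ = ‖y‖ := by
  have key : ∀ z : H, ‖z‖ ^ 2 = ∑' m, ‖inner ℂ (b m) z‖ ^ 2 := fun z => by
    have := lp.norm_rpow_eq_tsum (p := 2) (by norm_num) (b.repr z)
    simpa [b.repr_apply_apply] using this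
  have : ‖x‖ ^ 2 = ‖y‖ ^ 2 := by rw [key, key]; simp [h]
  exact (sq_eq_sq₀ (norm_nonneg _) (norm_nonneg _)).mp this

/-- Parseval's identity for vector-valued finite sums of orthonormal unimodular functions. -/
theorem integral_norm_sq_sum_smul {ι Θ : Type*} [MeasurableSpace Θ] (μ : Measure Θ)
    [IsProbabilityMeasure μ] (χ : ι → Θ → ℂ) (hχm : ∀ m, Measurable (χ m))
    (hχ1 : ∀ m t, ‖χ m t‖ = 1)
    (hχo : ∀ m m', m ≠ m' → ∫ t, starRingEnd ℂ (χ m t) * χ m' t ∂μ = 0)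
    (G : Finset ι) (v : ι → H) :
    Integrable (fun t => ‖∑ m ∈ G, χ m t • v m‖ ^ 2) μ ∧
      ∫ t, ‖∑ m ∈ G, χ m t • v m‖ ^ 2 ∂μ = ∑ m ∈ G, ‖v m‖ ^ 2 := by
  classical
  have hint : ∀ m m', Integrable (fun t => starRingEnd ℂ (χ m t) * χ m' t) μ := fun m m' =>
    Integrable.of_bound (C := 1)
      ((RCLike.continuous_conj.measurable.comp (hχm m)).mul (hχm m')).aestronglyMeasurable
      (Eventually.of_forall fun t => by simp [hχ1])
  have hexp : ∀ t, ((‖∑ m ∈ G, χ m t • v m‖ ^ 2 : ℝ) : ℂ)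
      = ∑ m ∈ G, ∑ m' ∈ G, starRingEnd ℂ (χ m t) * χ m' t * inner ℂ (v m) (v m') := fun t => by
    have := inner_self_eq_norm_sq_to_K (𝕜 := ℂ) (∑ m ∈ G, χ m t • v m)
    push_cast
    refine this.symm.trans ?_
    simp only [sum_inner, inner_sum, inner_smul_left, inner_smul_right, Finset.mul_sum]
    rw [Finset.sum_comm]
    exact Finset.sum_congr rfl fun m _ => Finset.sum_congr rfl fun m' _ => by ring
  have hdiag : ∀ m, ∫ t, starRingEnd ℂ (χ m t) * χ m t ∂μ = 1 := fun m => by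
    simp [RCLike.conj_mul, hχ1]
  have hI : Integrable (fun t => ((‖∑ m ∈ G, χ m t • v m‖ ^ 2 : ℝ) : ℂ)) μ := by
    simp only [hexp]
    exact integrable_finsetSum _ fun m _ => integrable_finsetSum _ fun m' _ =>
      (hint m m').mul_const _
  refine ⟨hI.re, ?_⟩
  have : ((∫ t, ‖∑ m ∈ G, χ m t • v m‖ ^ 2 ∂μ : ℝ) : ℂ) = ((∑ m ∈ G, ‖v m‖ ^ 2 : ℝ) : ℂ) := by
    rw [← integral_complex_ofReal]
    simp only [hexp]
    rw [integral_finsetSum _ fun m _ => integrable_finsetSum _ fun m' _ =>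
      (hint m m').mul_const _]
    push_cast
    refine Finset.sum_congr rfl fun m hm => ?_
    rw [integral_finsetSum _ fun m' _ => (hint m m').mul_const _, Finset.sum_eq_single m]
    · rw [integral_mul_const, hdiag, one_mul, inner_self_eq_norm_sq_to_K]; rfl
    · intro m' _ hne
      rw [integral_mul_const, hχo m m' hne.symm, zero_mul]
    · exact fun h => absurd hm h
  exact_mod_cast this

variable [CompleteSpace H]

/-- An operator that is small on the orthogonal complements of finite-dimensional subspaces is
compact. -/
theorem isCompactOperator_of_small_on_orthogonal (T : H →L[ℂ] H)
    (h : ∀ ε > 0, ∃ V : Submodule ℂ H, FiniteDimensional ℂ V ∧ ∀ u ∈ Vᗮ, ‖T u‖ ≤ ε * ‖u‖) :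
    IsCompactOperator T := by
  have hcl : T ∈ closure {T : H →L[ℂ] H | IsCompactOperator T} := by
    rw [Metric.mem_closure_iff]
    intro ε hε
    obtain ⟨V, hV, hVT⟩ := h (ε / 2) (half_pos hε)
    refine ⟨T ∘L V.starProjection, ?_, ?_⟩
    · have h1 : IsCompactOperator V.orthogonalProjectionOnto :=
        isCompactOperator_of_locallyCompactSpace_dom _
      exact h1.clm_comp (T ∘L V.subtypeL)
    · rw [dist_eq_norm]
      refine lt_of_le_of_lt (ContinuousLinearMap.opNorm_le_bound _ (half_pos hε).le fun u => ?_)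
        (half_lt_self hε)
      have hu : u - V.starProjection u ∈ Vᗮ := V.sub_starProjection_mem_orthogonal u
      have hn : ‖u - V.starProjection u‖ ≤ ‖u‖ := by
        rw [← Submodule.starProjection_orthogonal_val]
        exact Vᗮ.norm_starProjection_apply_le u
      calc ‖(T - T ∘L V.starProjection) u‖ = ‖T (u - V.starProjection u)‖ := by simp
        _ ≤ ε / 2 * ‖u - V.starProjection u‖ := hVT _ hu
        _ ≤ ε / 2 * ‖u‖ := by gcongr
  exact isClosed_setOfPred_isCompactOperator.closure_subset hcl

/-- Compact operators map bounded weakly null families to norm null families. -/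
theorem IsCompactOperator.tendsto_norm_of_weakly_null {α : Type*} {l : Filter α}
    {T : H →L[ℂ] H} (hT : IsCompactOperator T) {v : α → H} {C : ℝ} (hC : ∀ a, ‖v a‖ ≤ C)
    (hv : ∀ y, Tendsto (fun a => inner ℂ y (v a)) l (𝓝 0)) :
    Tendsto (fun a => ‖T (v a)‖) l (𝓝 0) := by
  obtain ⟨K, hK, hsub⟩ := hT.image_closedBall_subset_compact C
  rw [← tendsto_zero_iff_norm_tendsto_zero]
  refine hK.tendsto_nhds_of_unique_mapClusterPt
    (Eventually.of_forall fun a => hsub ⟨v a, by simpa using hC a, rfl⟩) fun z _ hz => ?_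
  have h1 : MapClusterPt (inner ℂ z z : ℂ) l (fun a => inner ℂ z (T (v a))) :=
    hz.continuousAt_comp (f := fun w => inner ℂ z w) (by fun_prop)
  have h2 : Tendsto (fun a => inner ℂ z (T (v a))) l (𝓝 0) := by
    simpa only [ContinuousLinearMap.adjoint_inner_left] using hv (T.adjoint z)
  have h3 : inner ℂ z z = (0 : ℂ) := by
    have : (𝓝 (inner ℂ z z : ℂ) ⊓ 𝓝 0).NeBot := h1.neBot.mono (inf_le_inf_left _ h2)
    exact eq_of_nhds_neBot this
  exact inner_self_eq_zero.mp h3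

/-- Compactness criterion: if `S` tends to zero along a Hilbert basis and is almost unchanged, on
the range of `P`, by the diagonal unitaries with entries `χ · t` for `t` in a set of positive
measure, then `S P` is compact. -/
theorem isCompactOperator_comp_of_diagonal {ι Θ : Type*} [MeasurableSpace Θ] (μ : Measure Θ)
    [IsProbabilityMeasure μ] (b : HilbertBasis ι ℂ H) (χ : ι → Θ → ℂ)
    (hχm : ∀ m, Measurable (χ m)) (hχ1 : ∀ m t, ‖χ m t‖ = 1)
    (hχo : ∀ m m', m ≠ m' → ∫ t, starRingEnd ℂ (χ m t) * χ m' t ∂μ = 0)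
    (S P : H →L[ℂ] H) (hS : Tendsto (fun m => ‖S (b m)‖) cofinite (𝓝 0))
    (hV : ∀ ε > 0, ∃ U, MeasurableSet U ∧ 0 < μ U ∧ ∀ t ∈ U, ∀ u, ∃ w,
      (∀ m, inner ℂ (b m) w = χ m t * inner ℂ (b m) (P u)) ∧ ‖S (P u)‖ ≤ ‖S w‖ + ε * ‖u‖) :
    IsCompactOperator (S ∘L P) := by
  classical
  refine isCompactOperator_of_small_on_orthogonal _ fun ε₀ hε₀ => ?_
  obtain ⟨ε, hε, hεε⟩ : ∃ ε > 0, ε * (1 + ‖P‖) = ε₀ :=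
    ⟨ε₀ / (1 + ‖P‖), by positivity, by field_simp⟩
  obtain ⟨U, hUm, hU0, hU⟩ := hV ε hε
  have ha : 0 < μ.real U := ENNReal.toReal_pos hU0.ne' (measure_ne_top μ U)
  have hfin : {m | ¬ ‖S (b m)‖ < ε * √(μ.real U)}.Finite := by
    have := hS.eventually_lt_const (show 0 < ε * √(μ.real U) by positivity)
    exact this
  set F := hfin.toFinset with hF
  refine ⟨Submodule.span ℂ (F.image fun m => P.adjoint (b m) : Finset H),
    FiniteDimensional.span_finset ℂ _, fun u hu => ?_⟩
  have hc0 : ∀ m ∈ F, inner ℂ (b m) (P u) = 0 := fun m hm => by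
    rw [← ContinuousLinearMap.adjoint_inner_left]
    exact (Submodule.mem_orthogonal _ _).mp hu _
      (Submodule.subset_span (by simpa using ⟨m, hm, rfl⟩))
  suffices hδ : ∀ δ > 0, ‖S (P u)‖ ≤ ε₀ * ‖u‖ + ‖S‖ * δ by
    have hlim : Tendsto (fun δ : ℝ => ε₀ * ‖u‖ + ‖S‖ * δ) (𝓝[>] 0) (𝓝 (ε₀ * ‖u‖ + ‖S‖ * 0)) :=
      ((by fun_prop : Continuous fun δ : ℝ => ε₀ * ‖u‖ + ‖S‖ * δ).tendsto 0).mono_left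
        nhdsWithin_le_nhds
    rw [mul_zero, add_zero] at hlim
    exact ge_of_tendsto hlim (eventually_mem_nhdsWithin.mono hδ)
  intro δ hδ
  obtain ⟨G, hG⟩ : ∃ G : Finset ι, ‖P u - ∑ m ∈ G, inner ℂ (b m) (P u) • b m‖ < δ := by
    have := (b.hasSum_repr (P u)).eventually (Metric.ball_mem_nhds _ hδ)
    obtain ⟨G, hG⟩ := this.exists
    refine ⟨G, ?_⟩
    rw [← dist_eq_norm, dist_comm]
    simpa [b.repr_apply_apply] using hG
  set c : ι → ℂ := fun m => inner ℂ (b m) (P u) with hc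
  obtain ⟨hΦi, hΦ⟩ := integral_norm_sq_sum_smul μ χ hχm hχ1 hχo G (fun m => c m • S (b m))
  have hup : ∑ m ∈ G, ‖c m • S (b m)‖ ^ 2 ≤ (ε * ‖P‖ * ‖u‖) ^ 2 * μ.real U := by
    have hterm : ∀ m ∈ G, ‖c m • S (b m)‖ ^ 2 ≤ ‖c m‖ ^ 2 * (ε ^ 2 * μ.real U) := fun m _ => by
      rw [norm_smul, mul_pow]
      by_cases hm : m ∈ F
      · simp [hc, hc0 m hm]
      · have hm' : ‖S (b m)‖ ≤ ε * √(μ.real U) := by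
          by_contra h'
          exact hm (by simpa [hF] using (not_le.mp h').le)
        gcongr
        calc ‖S (b m)‖ ^ 2 ≤ (ε * √(μ.real U)) ^ 2 := by gcongr
          _ = _ := by rw [mul_pow, Real.sq_sqrt ha.le]
    calc _ ≤ ∑ m ∈ G, ‖c m‖ ^ 2 * (ε ^ 2 * μ.real U) := Finset.sum_le_sum hterm
      _ = (∑ m ∈ G, ‖c m‖ ^ 2) * (ε ^ 2 * μ.real U) := by rw [Finset.sum_mul]
      _ ≤ ‖P u‖ ^ 2 * (ε ^ 2 * μ.real U) := by
        gcongr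
        exact b.orthonormal.sum_inner_products_le (P u)
      _ ≤ (‖P‖ * ‖u‖) ^ 2 * (ε ^ 2 * μ.real U) := by gcongr; exact P.le_opNorm u
      _ = _ := by ring
  by_contra hcon
  push Not at hcon
  set r := ‖S (P u)‖ - ε * ‖u‖ - ‖S‖ * δ with hr
  have hr0 : ε * ‖P‖ * ‖u‖ < r := by rw [hr]; rw [← hεε] at hcon; linarith
  have hlow : ∀ t ∈ U, r ^ 2 ≤ ‖∑ m ∈ G, χ m t • c m • S (b m)‖ ^ 2 := fun t ht => by
    obtain ⟨w, hw, hSw⟩ := hU t ht u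
    have hnorm : ‖w - ∑ m ∈ G, χ m t • c m • b m‖ = ‖P u - ∑ m ∈ G, c m • b m‖ := by
      refine b.norm_eq_of_norm_inner_eq fun m => ?_
      have hb : ∀ m', inner ℂ (b m) (b m') = if m = m' then (1 : ℂ) else 0 :=
        fun m' => orthonormal_iff_ite.mp b.orthonormal m m'
      simp only [inner_sub_right, inner_sum, inner_smul_right, hb, hw]
      by_cases hm : m ∈ G <;> simp [hm, hc, hχ1]
    have h1 : ‖S w‖ ≤ ‖∑ m ∈ G, χ m t • c m • S (b m)‖ + ‖S‖ * δ := by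
      calc ‖S w‖ = ‖S (∑ m ∈ G, χ m t • c m • b m) + S (w - ∑ m ∈ G, χ m t • c m • b m)‖ := by
            rw [← map_add]; simp
        _ ≤ ‖S (∑ m ∈ G, χ m t • c m • b m)‖ + ‖S (w - ∑ m ∈ G, χ m t • c m • b m)‖ :=
            norm_add_le _ _
        _ ≤ ‖∑ m ∈ G, χ m t • c m • S (b m)‖ + ‖S‖ * δ := by
            gcongr
            · simp
            · refine (S.le_opNorm _).trans ?_
              rw [hnorm]
              gcongr
    have hrpos : 0 ≤ r := le_trans (by positivity) hr0.le
    gcongr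
    rw [hr]; linarith
  have hle : r ^ 2 * μ.real U ≤ (ε * ‖P‖ * ‖u‖) ^ 2 * μ.real U := by
    refine le_trans ?_ hup
    rw [← hΦ]
    calc r ^ 2 * μ.real U = ∫ _ in U, r ^ 2 ∂μ := by simp [mul_comm]
      _ ≤ ∫ t in U, ‖∑ m ∈ G, χ m t • c m • S (b m)‖ ^ 2 ∂μ :=
        setIntegral_mono_on (integrableOn_const (measure_ne_top μ U)) hΦi.integrableOn hUm hlow
      _ ≤ _ := setIntegral_le_integral hΦi (Eventually.of_forall fun t => by positivity)
  have hlt : (ε * ‖P‖ * ‖u‖) ^ 2 < r ^ 2 := by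
    have : 0 ≤ ε * ‖P‖ * ‖u‖ := by positivity
    gcongr
  exact absurd (le_of_mul_le_mul_right hle ha) (not_le.mpr hlt)

end HilbertSpace

section Phase

/-- The unimodular number `exp(i s)`. -/
def phase (s : ℝ) : ℂ := Complex.exp (Complex.I * (s : ℂ))

theorem phase_add (s t : ℝ) : phase (s + t) = phase s * phase t := by
  simp [phase, mul_add, Complex.exp_add]

@[simp] theorem phase_zero : phase 0 = 1 := by simp [phase]

@[simp] theorem norm_phase (s : ℝ) : ‖phase s‖ = 1 := by
  rw [phase, mul_comm, Complex.norm_exp_ofReal_mul_I]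

theorem conj_phase (s : ℝ) : starRingEnd ℂ (phase s) = phase (-s) := by
  simp [phase, ← Complex.exp_conj]

@[fun_prop] theorem continuous_phase : Continuous phase := by unfold phase; fun_prop

theorem norm_phase_sub_le (s t : ℝ) : ‖phase s - phase t‖ ≤ |s - t| := by
  have h : phase s - phase t = phase t * (phase (s - t) - 1) := by
    rw [mul_sub, ← phase_add]; simp
  rw [h, norm_mul, norm_phase, one_mul]
  exact Real.norm_exp_I_mul_ofReal_sub_one_le

theorem phase_sum {ι : Type*} (F : Finset ι) (f : ι → ℝ) :
    phase (∑ i ∈ F, f i) = ∏ i ∈ F, phase (f i) := by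
  simp [phase, Finset.mul_sum, Complex.exp_sum]

end Phase

section Weyl

variable {n : ℕ} {W : Xi n → (Hn n →L[ℂ] Hn n)}

theorem ae_comp_sub {p : (Fin n → ℝ) → Prop} (h : ∀ᵐ y, p y) (x : Fin n → ℝ) :
    ∀ᵐ y, p (y - x) :=
  (measurePreserving_sub_right volume x).quasiMeasurePreserving.ae h

theorem IsWeylFamily.ae_eq (hW : IsWeylFamily n W) (x ξ : Fin n → ℝ) (u : Hn n) :
    ∀ᵐ y, W (x, ξ) u y = phase ((y - (2⁻¹ : ℝ) • x) ⬝ᵥ ξ) * u (y - x) := hW x ξ u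

theorem IsWeylFamily.apply_apply (hW : IsWeylFamily n W) (X Y : Xi n) (u : Hn n) :
    W X (W Y u) = phase (2⁻¹ * (Y.1 ⬝ᵥ X.2 - X.1 ⬝ᵥ Y.2)) • W (X + Y) u := by
  obtain ⟨x, ξ⟩ := X
  obtain ⟨y, η⟩ := Y
  apply Lp.ext
  filter_upwards [hW.ae_eq x ξ (W (y, η) u), ae_comp_sub (hW.ae_eq y η u) x,
    hW.ae_eq (x + y) (ξ + η) u,
    Lp.coeFn_smul (phase (2⁻¹ * (y ⬝ᵥ ξ - x ⬝ᵥ η))) (W (x + y, ξ + η) u)] with z h1 h2 h3 h4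
  simp only [Prod.mk_add_mk]
  rw [h1, h2, h4, Pi.smul_apply, h3, smul_eq_mul, ← mul_assoc, ← mul_assoc, ← phase_add,
    ← phase_add, sub_sub z x y]
  congr 2
  simp only [sub_dotProduct, smul_dotProduct, dotProduct_add, add_dotProduct, smul_add,
    smul_eq_mul]
  ring

theorem IsWeylFamily.apply_zero (hW : IsWeylFamily n W) (u : Hn n) : W 0 u = u := by
  rw [← Prod.mk_zero_zero]
  apply Lp.ext
  filter_upwards [hW.ae_eq 0 0 u] with z h
  simpa using h

theorem IsWeylFamily.star_eq (hW : IsWeylFamily n W)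
    (hWU : ∀ X : Xi n, W X ∈ unitary (Hn n →L[ℂ] Hn n)) (X : Xi n) : star (W X) = W (-X) := by
  have h : W X * W (-X) = 1 := by
    ext1 u
    simp [hW.apply_apply, hW.apply_zero, mul_comm, dotProduct_comm]
  calc star (W X) = star (W X) * (W X * W (-X)) := by rw [h, mul_one]
    _ = W (-X) := by rw [← mul_assoc, Unitary.star_mul_self_of_mem (hWU X), one_mul]

theorem IsWeylFamily.mul_eq (hW : IsWeylFamily n W) (X Y : Xi n) :
    W X * W Y = phase (2⁻¹ * (Y.1 ⬝ᵥ X.2 - X.1 ⬝ᵥ Y.2)) • W (X + Y) := by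
  ext1 u
  exact hW.apply_apply X Y u

theorem norm_unitary_apply {U : Hn n →L[ℂ] Hn n} (hU : U ∈ unitary (Hn n →L[ℂ] Hn n))
    (u : Hn n) : ‖U u‖ = ‖u‖ :=
  ContinuousLinearMap.norm_map_of_mem_unitary hU u

theorem Tconj_add (hW : IsWeylFamily n W) (X Y : Xi n) (S : Hn n →L[ℂ] Hn n) :
    Tconj n W (X + Y) S = Tconj n W X (Tconj n W Y S) := by
  set c := phase (2⁻¹ * (Y.1 ⬝ᵥ X.2 - X.1 ⬝ᵥ Y.2)) with hc
  have h : W X * W Y = c • W (X + Y) := hW.mul_eq X Y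
  have hcc : c * star c = 1 := by
    rw [← starRingEnd_apply, RCLike.mul_conj]; simp [hc]
  calc Tconj n W (X + Y) S = (c * star c) • Tconj n W (X + Y) S := by rw [hcc, one_smul]
    _ = (c • W (X + Y)) * S * star (c • W (X + Y)) := by
      simp [Tconj, star_smul, smul_smul, mul_comm]
    _ = _ := by rw [← h, star_mul]; simp only [Tconj, mul_assoc]

theorem star_Tconj (X : Xi n) (S : Hn n →L[ℂ] Hn n) :
    star (Tconj n W X S) = Tconj n W X (star S) := by
  simp [Tconj, mul_assoc]

theorem norm_Tconj_apply (hWU : ∀ X : Xi n, W X ∈ unitary (Hn n →L[ℂ] Hn n)) (X : Xi n)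
    (S : Hn n →L[ℂ] Hn n) (u : Hn n) : ‖Tconj n W X S u‖ = ‖S (star (W X) u)‖ :=
  norm_unitary_apply (hWU X) _

theorem norm_Tconj_le (hWU : ∀ X : Xi n, W X ∈ unitary (Hn n →L[ℂ] Hn n)) (X : Xi n)
    (S : Hn n →L[ℂ] Hn n) : ‖Tconj n W X S‖ ≤ ‖S‖ := by
  refine ContinuousLinearMap.opNorm_le_bound _ (norm_nonneg _) fun u => ?_
  rw [norm_Tconj_apply hWU]
  refine (S.le_opNorm _).trans_eq ?_
  rw [norm_unitary_apply (Unitary.star_mem (hWU X))]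

theorem Tconj_zero (hW : IsWeylFamily n W) (S : Hn n →L[ℂ] Hn n) : Tconj n W 0 S = S := by
  have h : W 0 = 1 := by ext1 u; exact hW.apply_zero u
  simp [Tconj, h]

theorem Tconj_mem_B0 (hW : IsWeylFamily n W) {S : Hn n →L[ℂ] Hn n} (hS : S ∈ B0 n W)
    (Y : Xi n) : Tconj n W Y S ∈ B0 n W := by
  have h : Continuous fun X : Xi n => Tconj n W (X + Y) S :=
    Continuous.comp (g := fun X => Tconj n W X S) hS (by fun_prop)
  simpa only [B0, Set.mem_ofPred_eq, Tconj_add hW] using h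

/-- An operator in `B⁰` almost commutes with `W X` for small `X`. -/
theorem norm_apply_le_of_Tconj_sub (hWU : ∀ X : Xi n, W X ∈ unitary (Hn n →L[ℂ] Hn n))
    (S : Hn n →L[ℂ] Hn n) (X : Xi n) (u : Hn n) :
    ‖S u‖ ≤ ‖S (W X u)‖ + ‖Tconj n W X S - S‖ * ‖u‖ := by
  have h : W X (S u) = S (W X u) + (Tconj n W X S - S) (W X u) := by
    have h1 : star (W X) (W X u) = u := by
      have := Unitary.star_mul_self_of_mem (hWU X)
      exact congrArg (fun A : Hn n →L[ℂ] Hn n => A u) this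
    simp [Tconj, h1]
  calc ‖S u‖ = ‖W X (S u)‖ := (norm_unitary_apply (hWU X) _).symm
    _ ≤ ‖S (W X u)‖ + ‖(Tconj n W X S - S) (W X u)‖ := h ▸ norm_add_le _ _
    _ ≤ _ := by
      gcongr
      refine (ContinuousLinearMap.le_opNorm _ _).trans_eq ?_
      rw [norm_unitary_apply (hWU X)]

end Weyl

section CubeBasis

variable {n : ℕ} {W : Xi n → (Hn n →L[ℂ] Hn n)}

/-- The half-open unit cube `(0, 1]ⁿ`. -/
def unitCube (n : ℕ) : Set (Fin n → ℝ) := Set.univ.pi fun _ => Set.Ioc 0 1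

theorem measurableSet_unitCube : MeasurableSet (unitCube n) :=
  MeasurableSet.univ_pi fun _ => measurableSet_Ioc

theorem volume_unitCube : volume (unitCube n) = 1 := by
  simp [unitCube, volume_pi_pi]

instance : IsProbabilityMeasure (volume.restrict (unitCube n)) :=
  ⟨by rw [Measure.restrict_apply_univ, volume_unitCube]⟩

theorem eq_ceil_of_sub_mem_unitCube {y : Fin n → ℝ} {k : Fin n → ℤ}
    (h : (y - fun i => (k i : ℝ)) ∈ unitCube n) (i : Fin n) : k i = ⌈y i⌉ - 1 := by
  have h1 := h i (Set.mem_univ i)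
  simp only [Pi.sub_apply, Set.mem_Ioc] at h1
  have : ⌈y i⌉ = k i + 1 := by
    rw [Int.ceil_eq_iff]
    push_cast
    constructor <;> linarith
  omega

theorem sub_ceil_mem_unitCube (y : Fin n → ℝ) :
    (y - fun i => ((⌈y i⌉ - 1 : ℤ) : ℝ)) ∈ unitCube n := fun i _ => by
  have h1 := Int.le_ceil (y i)
  have h2 := Int.ceil_lt_add_one (y i)
  simp only [Pi.sub_apply, Set.mem_Ioc]
  push_cast
  constructor <;> linarith

/-- The point `(k, 2πl)` of phase space. -/
def latticePoint (m : (Fin n → ℤ) × (Fin n → ℤ)) : Xi n :=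
  (fun i => (m.1 i : ℝ), fun i => 2 * Real.pi * (m.2 i : ℝ))

theorem latticePoint_add (m m' : (Fin n → ℤ) × (Fin n → ℤ)) :
    latticePoint (m + m') = latticePoint m + latticePoint m' := by
  ext i <;> simp [latticePoint, mul_add]

theorem integral_phase_Ioc (l : ℤ) :
    ∫ y in Set.Ioc (0 : ℝ) 1, phase (y * (2 * Real.pi * l)) = if l = 0 then 1 else 0 := by
  split_ifs with h
  · simp [h]
  · have hc : (2 * Real.pi * l * Complex.I : ℂ) ≠ 0 := by
      simp [Real.pi_ne_zero, h]
    have hexp := integral_exp_mul_complex (a := 0) (b := 1) hc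
    rw [← intervalIntegral.integral_of_le zero_le_one]
    have h1 : Complex.exp (2 * Real.pi * l * Complex.I) = 1 := by
      rw [Complex.exp_eq_one_iff]
      exact ⟨l, by ring⟩
    calc _ = ∫ y in (0 : ℝ)..1, Complex.exp (2 * Real.pi * l * Complex.I * y) := by
          refine intervalIntegral.integral_congr fun y _ => ?_
          simp only [phase]
          congr 1
          push_cast
          ring
      _ = 0 := by rw [hexp]; simp [h1]

theorem integral_phase_unitCube (l : Fin n → ℤ) :
    ∫ y in unitCube n, phase (y ⬝ᵥ fun i => 2 * Real.pi * (l i : ℝ)) = if l = 0 then 1 else 0 := by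
  have h1 : (volume.restrict (unitCube n) : Measure (Fin n → ℝ))
      = Measure.pi fun _ => volume.restrict (Set.Ioc 0 1) := by
    rw [unitCube, volume_pi, Measure.restrict_pi_pi]
  simp only [dotProduct, phase_sum]
  rw [h1, integral_fintype_prod_eq_prod
    (fun i (y : ℝ) => phase (y * (2 * Real.pi * (l i : ℝ))))]
  simp only [integral_phase_Ioc]
  split_ifs with h
  · simp [h]
  · obtain ⟨i, hi⟩ := Function.ne_iff.mp h
    exact Finset.prod_eq_zero (Finset.mem_univ i) (by simpa using hi)

/-- A square integrable function on the unit cube is determined by its Fourier coefficients. -/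
theorem ae_eq_zero_of_fourier_eq_zero {f : (Fin n → ℝ) → ℂ}
    (hf : MemLp f 2 (volume.restrict (unitCube n)))
    (h : ∀ l : Fin n → ℤ,
      ∫ y in unitCube n, phase (-(y ⬝ᵥ fun i => 2 * Real.pi * (l i : ℝ))) * f y = 0) :
    f =ᵐ[volume.restrict (unitCube n)] 0 := by
  have hset : {x : Fin n → ℝ | ∀ i, x i ∈ Set.Ioc ((0 : Fin n → ℝ) i) ((0 : Fin n → ℝ) i + 1)}
      = unitCube n := by ext; simp [unitCube]
  have hm : MeasurableSet {x : Fin n → ℝ | ∀ i, x i ∈ Set.Ioc ((0 : Fin n → ℝ) i)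
    ((0 : Fin n → ℝ) i + 1)} := hset ▸ measurableSet_unitCube
  have hsub : MeasurePreserving
      (Subtype.val : {x : Fin n → ℝ // ∀ i, x i ∈ Set.Ioc ((0 : Fin n → ℝ) i)
        ((0 : Fin n → ℝ) i + 1)} → (Fin n → ℝ))
      (Measure.comap Subtype.val volume) (volume.restrict (unitCube n)) :=
    hset ▸ measurePreserving_subtype_coe hm
  have hmp := hsub.comp (UnitAddTorus.measurePreserving_equivPiIoc (0 : Fin n → ℝ))
  have hF := hf.comp_measurePreserving hmp
  have hzero : hF.toLp = 0 := by
    apply UnitAddTorus.mFourierBasis.repr.injective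
    rw [map_zero]
    ext l
    have hcongr : UnitAddTorus.mFourierCoeff (⇑hF.toLp) l = UnitAddTorus.mFourierCoeff
        (f ∘ Subtype.val ∘ UnitAddTorus.measurableEquivPiIoc (0 : Fin n → ℝ)) l :=
      integral_congr_ae (hF.coeFn_toLp.mono fun x hx => congrArg (_ • ·) hx)
    rw [UnitAddTorus.mFourierBasis_repr, hcongr, UnitAddTorus.mFourierCoeff_eq_integral _ _ 0, hset]
    refine Eq.trans ?_ (h l)
    refine setIntegral_congr_fun measurableSet_unitCube fun y hy => ?_
    have hy' : ∀ i, y i ∈ Set.Ioc ((0 : Fin n → ℝ) i) ((0 : Fin n → ℝ) i + 1) := hset.ge hy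
    simp only [Function.comp_apply, UnitAddTorus.coe_measurableEquivPiIoc_apply,
      fun i => AddCircle.equivIoc_coe_eq (hy' i), smul_eq_mul]
    congr 1
    simp only [UnitAddTorus.mFourier, ContinuousMap.coe_mk, dotProduct, ← Finset.sum_neg_distrib,
      phase_sum]
    refine Finset.prod_congr rfl fun i _ => ?_
    rw [fourier_coe_apply, phase]
    congr 1
    push_cast [Pi.neg_apply]
    ring
  have hnorm := eLpNorm_comp_measurePreserving (p := 2) hf.1 hmp
  rw [← eLpNorm_congr_ae hF.coeFn_toLp, hzero, eLpNorm_congr_ae (Lp.coeFn_zero ..), eLpNorm_zero,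
    eq_comm, eLpNorm_eq_zero_iff hf.1 two_ne_zero] at hnorm
  exact hnorm

end CubeBasis

section CubeHilbertBasis

variable {n : ℕ} {W : Xi n → (Hn n →L[ℂ] Hn n)}

/-- The indicator function of the unit cube, as an element of `L²`. -/
def cubeFun (n : ℕ) : Hn n :=
  indicatorConstLp 2 measurableSet_unitCube (by simp [volume_unitCube]) (1 : ℂ)

theorem norm_cubeFun : ‖cubeFun n‖ = 1 := by
  rw [cubeFun, norm_indicatorConstLp two_ne_zero ENNReal.ofNat_ne_top]
  simp [measureReal_def, volume_unitCube]

theorem inner_weyl_left (hWU : ∀ X : Xi n, W X ∈ unitary (Hn n →L[ℂ] Hn n))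
    (hW : IsWeylFamily n W) (X : Xi n) (u v : Hn n) :
    inner ℂ (W X u) v = inner ℂ u (W (-X) v) := by
  rw [← hW.star_eq hWU, ContinuousLinearMap.star_eq_adjoint,
    ContinuousLinearMap.adjoint_inner_right]

theorem inner_weyl_cubeFun (hWU : ∀ X : Xi n, W X ∈ unitary (Hn n →L[ℂ] Hn n))
    (hW : IsWeylFamily n W) (x ξ : Fin n → ℝ) (v : Hn n) :
    inner ℂ (W (x, ξ) (cubeFun n)) v
      = phase (-(2⁻¹ * (x ⬝ᵥ ξ))) * ∫ y in unitCube n, phase (-(y ⬝ᵥ ξ)) * v (y + x) := by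
  rw [inner_weyl_left hWU hW, cubeFun, L2.inner_indicatorConstLp_one, ← integral_const_mul]
  refine integral_congr_ae (ae_restrict_of_ae ?_)
  filter_upwards [hW.ae_eq (-x) (-ξ) v] with y hy
  rw [Prod.neg_mk, hy, ← mul_assoc, ← phase_add, sub_neg_eq_add]
  congr 2
  simp

theorem inner_weyl_cubeFun_eq_zero (hWU : ∀ X : Xi n, W X ∈ unitary (Hn n →L[ℂ] Hn n))
    (hW : IsWeylFamily n W) {m m' : (Fin n → ℤ) × (Fin n → ℤ)} (h : m ≠ m') :
    inner ℂ (W (latticePoint m) (cubeFun n)) (W (latticePoint m') (cubeFun n)) = 0 := by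
  obtain ⟨k, l⟩ := m
  obtain ⟨k', l'⟩ := m'
  rw [latticePoint, inner_weyl_cubeFun hWU hW]
  refine mul_eq_zero_of_right _ ?_
  have hκ : ∀ᵐ y : Fin n → ℝ, cubeFun n y = (unitCube n).indicator (fun _ => 1) y :=
    indicatorConstLp_coeFn
  have hae : ∀ᵐ y : Fin n → ℝ, (W (latticePoint (k', l')) (cubeFun n)) (y + fun i => (k i : ℝ))
      = phase ((y + (fun i => (k i : ℝ)) - (2⁻¹ : ℝ) • fun i => (k' i : ℝ)) ⬝ᵥ
          fun i => 2 * Real.pi * (l' i : ℝ)) *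
        (unitCube n).indicator (fun _ => 1)
          (y + (fun i => (k i : ℝ)) - fun i => (k' i : ℝ)) := by
    have h1 := ae_comp_sub (hW.ae_eq (fun i => (k' i : ℝ)) (fun i => 2 * Real.pi * (l' i : ℝ))
      (cubeFun n)) (-fun i => (k i : ℝ))
    have h2 := ae_comp_sub (ae_comp_sub hκ (fun i => (k' i : ℝ))) (-fun i => (k i : ℝ))
    filter_upwards [h1, h2] with y h1 h2
    rw [sub_neg_eq_add] at h1 h2
    rw [latticePoint, h1, h2]
  by_cases hk : k = k'
  · subst hk
    have hl : l' - l ≠ 0 := fun h0 => h (by rw [sub_eq_zero.mp h0])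
    set c : ℝ := ((fun i => (k i : ℝ)) - (2⁻¹ : ℝ) • fun i => (k i : ℝ)) ⬝ᵥ
          fun i => 2 * Real.pi * (l' i : ℝ) with hc
    calc _ = ∫ y in unitCube n, phase c *
              phase (y ⬝ᵥ fun i => 2 * Real.pi * ((l' - l) i : ℝ)) := by
          refine integral_congr_ae ?_
          filter_upwards [ae_restrict_of_ae hae, ae_restrict_mem measurableSet_unitCube]
            with y hy hmem
          rw [hy, add_sub_cancel_right, Set.indicator_of_mem hmem, mul_one, ← phase_add,
            ← phase_add]
          congr 1
          have : (fun i => 2 * Real.pi * (((l' - l) i : ℤ) : ℝ))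
              = (fun i => 2 * Real.pi * (l' i : ℝ)) - fun i => 2 * Real.pi * (l i : ℝ) := by
            ext i; simp [mul_sub]
          rw [this, hc, add_sub_assoc, add_dotProduct, dotProduct_sub]
          ring
      _ = 0 := by rw [integral_const_mul, integral_phase_unitCube, if_neg hl, mul_zero]
  · refine integral_eq_zero_of_ae ?_
    filter_upwards [ae_restrict_of_ae hae, ae_restrict_mem measurableSet_unitCube] with y hy hmem
    rw [hy, Set.indicator_of_notMem, mul_zero, mul_zero, Pi.zero_apply]
    intro hmem'
    apply hk
    have h1 := eq_ceil_of_sub_mem_unitCube (y := y + fun i => (k i : ℝ)) (k := k)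
      (by rwa [add_sub_cancel_right])
    have h2 := eq_ceil_of_sub_mem_unitCube hmem'
    ext i
    rw [h1 i, h2 i]

theorem orthonormal_cube (hWU : ∀ X : Xi n, W X ∈ unitary (Hn n →L[ℂ] Hn n))
    (hW : IsWeylFamily n W) :
    Orthonormal ℂ fun m : (Fin n → ℤ) × (Fin n → ℤ) => W (latticePoint m) (cubeFun n) :=
  ⟨fun m => by rw [norm_unitary_apply (hWU _), norm_cubeFun],
    fun _ _ h => inner_weyl_cubeFun_eq_zero hWU hW h⟩

theorem eq_zero_of_inner_cube (hWU : ∀ X : Xi n, W X ∈ unitary (Hn n →L[ℂ] Hn n))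
    (hW : IsWeylFamily n W) {v : Hn n}
    (h : ∀ m, inner ℂ (W (latticePoint m) (cubeFun n)) v = 0) : v = 0 := by
  have hk : ∀ k : Fin n → ℤ, ∀ᵐ z : Fin n → ℝ,
      (z - fun i => (k i : ℝ)) ∈ unitCube n → v z = 0 := by
    intro k
    have hmem : MemLp (fun y => v (y + fun i => (k i : ℝ))) 2 (volume : Measure (Fin n → ℝ)) :=
      (Lp.memLp v).comp_measurePreserving (measurePreserving_add_right volume _)
    have h0 := ae_eq_zero_of_fourier_eq_zero (hmem.restrict (unitCube n)) fun l => by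
      have := h (k, l)
      rw [latticePoint, inner_weyl_cubeFun hWU hW] at this
      refine (mul_eq_zero.mp this).resolve_left fun h1 => ?_
      simpa [h1] using norm_phase (-(2⁻¹ * ((fun i => (k i : ℝ)) ⬝ᵥ
        fun i => 2 * Real.pi * (l i : ℝ))))
    rw [EventuallyEq, ae_restrict_iff' measurableSet_unitCube] at h0
    filter_upwards [ae_comp_sub h0 (fun i => (k i : ℝ))] with z hz hz'
    simpa using hz hz'
  rw [Lp.eq_zero_iff_ae_eq_zero]
  filter_upwards [ae_all_iff.mpr hk] with z hz
  exact hz _ (sub_ceil_mem_unitCube z)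

/-- The orthonormal basis of translated and modulated indicator functions of the unit cube. -/
def cubeBasis (hWU : ∀ X : Xi n, W X ∈ unitary (Hn n →L[ℂ] Hn n)) (hW : IsWeylFamily n W) :
    HilbertBasis ((Fin n → ℤ) × (Fin n → ℤ)) ℂ (Hn n) :=
  HilbertBasis.mkOfOrthogonalEqBot (orthonormal_cube hWU hW) <| by
    rw [Submodule.eq_bot_iff]
    intro v hv
    exact eq_zero_of_inner_cube hWU hW fun m =>
      hv _ (Submodule.subset_span (Set.mem_range_self m))

theorem cubeBasis_apply (hWU : ∀ X : Xi n, W X ∈ unitary (Hn n →L[ℂ] Hn n))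
    (hW : IsWeylFamily n W) (m : (Fin n → ℤ) × (Fin n → ℤ)) :
    cubeBasis hWU hW m = W (latticePoint m) (cubeFun n) := by
  rw [cubeBasis, HilbertBasis.coe_mkOfOrthogonalEqBot]

theorem tendsto_latticePoint_cofinite :
    Tendsto (latticePoint : (Fin n → ℤ) × (Fin n → ℤ) → Xi n) cofinite (cocompact (Xi n)) := by
  have h1 : Tendsto (fun (k : Fin n → ℤ) i => (k i : ℝ)) cofinite (cocompact (Fin n → ℝ)) := by
    rw [← coprodᵢ_cofinite, ← coprodᵢ_cocompact]
    exact Tendsto.pi_map_coprodᵢ fun _ => Int.tendsto_coe_cofinite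
  have h : Tendsto (fun j : ℤ => 2 * Real.pi * (j : ℝ)) cofinite (cocompact ℝ) :=
    (tendsto_cocompact_mul_left₀ (K := ℝ) Real.two_pi_pos.ne').comp Int.tendsto_coe_cofinite
  have h2 : Tendsto (fun (l : Fin n → ℤ) i => 2 * Real.pi * (l i : ℝ)) cofinite
      (cocompact (Fin n → ℝ)) := by
    rw [← coprodᵢ_cofinite, ← coprodᵢ_cocompact]
    exact Tendsto.pi_map_coprodᵢ fun _ => h
  rw [← coprod_cofinite, ← coprod_cocompact]
  exact h1.prodMap_coprod h2

end CubeHilbertBasis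

section CompactToDecay

variable {n : ℕ} {W : Xi n → (Hn n →L[ℂ] Hn n)}

theorem tendsto_inner_weyl_lattice (hWU : ∀ X : Xi n, W X ∈ unitary (Hn n →L[ℂ] Hn n))
    (hW : IsWeylFamily n W) (u y : Hn n) :
    Tendsto (fun m : (Fin n → ℤ) × (Fin n → ℤ) => inner ℂ y (W (-latticePoint m) u))
      cofinite (𝓝 0) := by
  set b := cubeBasis hWU hW with hb
  have hspan : ∀ z ∈ Submodule.span ℂ (Set.range b), Tendsto
      (fun m : (Fin n → ℤ) × (Fin n → ℤ) => inner ℂ z (W (-latticePoint m) u)) cofinite (𝓝 0) := by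
    intro z hz
    induction hz using Submodule.span_induction with
    | mem z hz =>
      obtain ⟨m', rfl⟩ := hz
      rw [tendsto_zero_iff_norm_tendsto_zero]
      have h1 : Tendsto (fun m => ‖inner ℂ (b m) u‖ ^ 2) cofinite (𝓝 0) :=
        (b.orthonormal.inner_products_summable u).tendsto_cofinite_zero
      have h2 : Tendsto (fun m => ‖inner ℂ (b m) u‖) cofinite (𝓝 0) := by
        simpa using h1.sqrt
      refine (h2.comp (add_left_injective m').tendsto_cofinite).congr fun m => ?_
      rw [← inner_weyl_left hWU hW, hb, cubeBasis_apply, hW.apply_apply, inner_smul_left, norm_mul,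
        RCLike.norm_conj, norm_phase, one_mul, Function.comp_apply, cubeBasis_apply,
        latticePoint_add]
    | zero => simpa using tendsto_const_nhds
    | add z z' _ _ h h' => simpa [inner_add_left] using h.add h'
    | smul c z _ h => simpa [inner_smul_left] using h.const_mul (starRingEnd ℂ c)
  rw [Metric.tendsto_nhds]
  intro ε hε
  have hy : y ∈ closure (Submodule.span ℂ (Set.range b) : Set (Hn n)) := by
    rw [← Submodule.topologicalClosure_coe, b.dense_span]
    trivial
  obtain ⟨z, hz, hyz⟩ := Metric.mem_closure_iff.mp hy (ε / (2 * (‖u‖ + 1))) (by positivity)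
  filter_upwards [Metric.tendsto_nhds.mp (hspan z hz) (ε / 2) (half_pos hε)] with m hm
  rw [dist_zero_right] at hm ⊢
  have h1 : inner ℂ y (W (-latticePoint m) u)
      = inner ℂ (y - z) (W (-latticePoint m) u) + inner ℂ z (W (-latticePoint m) u) := by
    rw [← inner_add_left, sub_add_cancel]
  have h2 : ‖inner ℂ (y - z) (W (-latticePoint m) u)‖ ≤ ε / (2 * (‖u‖ + 1)) * ‖u‖ := by
    refine (norm_inner_le_norm _ _).trans ?_
    rw [norm_unitary_apply (hWU _), ← dist_eq_norm]
    gcongr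
  have h3 : ε / (2 * (‖u‖ + 1)) * ‖u‖ ≤ ε / 2 := by
    rw [div_mul_eq_mul_div, div_le_div_iff₀ (by positivity) (by positivity)]
    nlinarith [norm_nonneg u]
  rw [h1]
  exact (norm_add_le _ _).trans_lt (by linarith)

theorem tendsto_norm_Tconj_lattice (hWU : ∀ X : Xi n, W X ∈ unitary (Hn n →L[ℂ] Hn n))
    (hW : IsWeylFamily n W) {S : Hn n →L[ℂ] Hn n} (hS : IsCompactOperator S) (u : Hn n) :
    Tendsto (fun m : (Fin n → ℤ) × (Fin n → ℤ) => ‖Tconj n W (latticePoint m) S u‖)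
      cofinite (𝓝 0) := by
  simp only [norm_Tconj_apply hWU, hW.star_eq hWU]
  exact hS.tendsto_norm_of_weakly_null (C := ‖u‖) (fun m => (norm_unitary_apply (hWU _) u).le)
    (tendsto_inner_weyl_lattice hWU hW u)

theorem isCompactOperator_Tconj {S : Hn n →L[ℂ] Hn n} (hS : IsCompactOperator S) (X : Xi n) :
    IsCompactOperator (Tconj n W X S) :=
  (hS.clm_comp (W X)).comp_clm (star (W X))

/-- The lattice part of a point of phase space. -/
def latticeFloor (X : Xi n) : (Fin n → ℤ) × (Fin n → ℤ) :=
  (fun i => ⌊X.1 i⌋, fun i => ⌊X.2 i / (2 * Real.pi)⌋)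

/-- A compact set containing a fundamental domain of the lattice in phase space. -/
def latticeBox (n : ℕ) : Set (Xi n) :=
  Set.Icc 0 (fun _ => 1) ×ˢ Set.Icc 0 (fun _ => 2 * Real.pi)

theorem isCompact_latticeBox : IsCompact (latticeBox n) := isCompact_Icc.prod isCompact_Icc

theorem sub_latticeFloor_mem (X : Xi n) : X - latticePoint (latticeFloor X) ∈ latticeBox n := by
  have hp := Real.two_pi_pos
  have key : ∀ t : ℝ, 0 ≤ t - 2 * Real.pi * ⌊t / (2 * Real.pi)⌋ ∧
      t - 2 * Real.pi * ⌊t / (2 * Real.pi)⌋ ≤ 2 * Real.pi := fun t => by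
    have h1 := Int.floor_le (t / (2 * Real.pi))
    have h2 := (Int.lt_floor_add_one (t / (2 * Real.pi))).le
    rw [le_div_iff₀ hp] at h1
    rw [div_le_iff₀ hp] at h2
    constructor <;> nlinarith
  refine ⟨⟨fun i => ?_, fun i => ?_⟩, fun i => (key (X.2 i)).1, fun i => (key (X.2 i)).2⟩
  · simp [latticePoint, latticeFloor]
  · simpa [latticePoint, latticeFloor] using (Int.fract_lt_one (X.1 i)).le

theorem tendsto_latticeFloor :
    Tendsto (latticeFloor : Xi n → (Fin n → ℤ) × (Fin n → ℤ)) (cocompact (Xi n)) cofinite := by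
  rw [tendsto_def]
  intro s hs
  have hcomp : IsCompact (⋃ m ∈ sᶜ, (latticePoint m + ·) '' latticeBox n) :=
    (mem_cofinite.mp hs).isCompact_biUnion fun m _ =>
      isCompact_latticeBox.image (by fun_prop)
  filter_upwards [hcomp.compl_mem_cocompact] with X hX
  by_contra h
  refine hX (Set.mem_biUnion h ⟨_, sub_latticeFloor_mem X, ?_⟩)
  simp

theorem tendsto_norm_Tconj_of_isCompactOperator
    (hWU : ∀ X : Xi n, W X ∈ unitary (Hn n →L[ℂ] Hn n)) (hW : IsWeylFamily n W)
    {S : Hn n →L[ℂ] Hn n} (hS : S ∈ B0 n W) (hc : IsCompactOperator S) (u : Hn n) :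
    Tendsto (fun X : Xi n => ‖Tconj n W X S u‖) (cocompact (Xi n)) (𝓝 0) := by
  have hcont : Continuous fun X : Xi n => Tconj n W X S := hS
  rw [Metric.tendsto_nhds]
  intro ε hε
  set δ := ε / (2 * (‖u‖ + 1)) with hδ
  have hδ0 : 0 < δ := by positivity
  obtain ⟨t, -, htc⟩ := (isCompact_latticeBox (n := n)).elim_nhds_subcover
    (fun Y => {X | ‖Tconj n W X S - Tconj n W Y S‖ < δ}) fun Y _ => by
      have h1 : Tendsto (fun X => ‖Tconj n W X S - Tconj n W Y S‖) (𝓝 Y) (𝓝 0) := by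
        simpa using (hcont.sub (continuous_const (y := Tconj n W Y S))).norm.tendsto Y
      exact h1.eventually_lt_const hδ0
  have hall : ∀ᶠ m : (Fin n → ℤ) × (Fin n → ℤ) in cofinite,
      ∀ Y ∈ t, ‖Tconj n W (latticePoint m) (Tconj n W Y S) u‖ < ε / 2 := by
    rw [Filter.eventually_all_finset]
    exact fun Y _ => (tendsto_norm_Tconj_lattice hWU hW
      (isCompactOperator_Tconj hc Y) u).eventually_lt_const (half_pos hε)
  filter_upwards [tendsto_latticeFloor.eventually hall] with X hX
  obtain ⟨Y, hYt, hY⟩ := Set.mem_iUnion₂.mp (htc (sub_latticeFloor_mem X))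
  set m := latticeFloor X
  set R := X - latticePoint m with hR
  have h1 : Tconj n W X S = Tconj n W (latticePoint m) (Tconj n W R S - Tconj n W Y S)
      + Tconj n W (latticePoint m) (Tconj n W Y S) := by
    have : X = latticePoint m + R := by rw [hR, add_sub_cancel]
    rw [this, Tconj_add hW]
    simp [Tconj, mul_sub, sub_mul]
  have h2 : ‖Tconj n W (latticePoint m) (Tconj n W R S - Tconj n W Y S) u‖ ≤ δ * ‖u‖ := by
    refine (ContinuousLinearMap.le_opNorm _ _).trans ?_
    gcongr
    exact (norm_Tconj_le hWU _ _).trans (le_of_lt hY)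
  have h3 : δ * ‖u‖ ≤ ε / 2 := by
    rw [hδ, div_mul_eq_mul_div, div_le_div_iff₀ (by positivity) (by positivity)]
    nlinarith [norm_nonneg u]
  rw [dist_zero_right, norm_norm, h1, _root_.add_apply]
  exact (norm_add_le _ _).trans_lt (by linarith [hX Y hYt])

theorem tendsto_norm_star_Tconj_of_isCompactOperator
    (hWU : ∀ X : Xi n, W X ∈ unitary (Hn n →L[ℂ] Hn n)) (hW : IsWeylFamily n W)
    {S : Hn n →L[ℂ] Hn n} (hS : S ∈ B0 n W) (hc : IsCompactOperator S) (u : Hn n) :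
    Tendsto (fun X : Xi n => ‖star (Tconj n W X S) u‖) (cocompact (Xi n)) (𝓝 0) := by
  have hmul : ∀ X, Tconj n W X (S * star S) = Tconj n W X S * star (Tconj n W X S) := fun X => by
    have h1 := Unitary.star_mul_self_of_mem (hWU X)
    calc Tconj n W X (S * star S) = W X * S * (star (W X) * W X) * star S * star (W X) := by
          rw [h1, mul_one, Tconj, mul_assoc, mul_assoc, mul_assoc, mul_assoc]
      _ = _ := by simp only [Tconj, star_mul, star_star, mul_assoc]
  have hB : S * star S ∈ B0 n W := by
    have hcont : Continuous fun X : Xi n => Tconj n W X S := hS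
    have : Continuous fun X : Xi n => Tconj n W X S * star (Tconj n W X S) := by fun_prop
    simpa only [B0, Set.mem_ofPred_eq, hmul] using this
  have h1 := tendsto_norm_Tconj_of_isCompactOperator hWU hW hB (hc.comp_clm (star S)) u
  have h2 : Tendsto (fun X => √(‖Tconj n W X (S * star S) u‖ * ‖u‖)) (cocompact (Xi n)) (𝓝 0) := by
    simpa using (h1.mul_const ‖u‖).sqrt
  refine squeeze_zero (fun _ => norm_nonneg _) (fun X => Real.le_sqrt_of_sq_le ?_) h2
  set A := Tconj n W X S with hA
  have h3 : inner ℂ (star A u) (star A u) = inner ℂ (Tconj n W X (S * star S) u) u := by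
    rw [hmul, ← hA, ContinuousLinearMap.star_eq_adjoint, ContinuousLinearMap.adjoint_inner_right]
    rfl
  rw [inner_self_eq_norm_sq_to_K] at h3
  have h4 := norm_inner_le_norm (𝕜 := ℂ) (Tconj n W X (S * star S) u) u
  rw [← h3] at h4
  simpa using h4

end CompactToDecay

section Cutoff

variable {n : ℕ} {W : Xi n → (Hn n →L[ℂ] Hn n)}

/-- Multiplication by the indicator function of a measurable set, as an operator on `L²`. -/
def cutoff {A : Set (Fin n → ℝ)} (hA : MeasurableSet A) : Hn n →L[ℂ] Hn n :=
  LinearMap.mkContinuous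
    { toFun := fun u => ((Lp.memLp u).indicator hA).toLp
      map_add' := fun u v => by
        rw [← MemLp.toLp_add]
        refine MemLp.toLp_congr _ _ ?_
        filter_upwards [Lp.coeFn_add u v] with y hy
        by_cases h : y ∈ A
        · simpa [h] using hy
        · simp [h]
      map_smul' := fun c u => by
        rw [RingHom.id_apply, ← MemLp.toLp_const_smul]
        refine MemLp.toLp_congr _ _ ?_
        filter_upwards [Lp.coeFn_smul c u] with y hy
        by_cases h : y ∈ A
        · simpa [h] using hy
        · simp [h] }
    1 fun u => by
      rw [one_mul]
      refine Lp.norm_le_norm_of_ae_le ?_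
      filter_upwards [((Lp.memLp u).indicator hA).coeFn_toLp] with y hy
      exact hy ▸ norm_indicator_le_norm_self _ _

theorem cutoff_ae_eq {A : Set (Fin n → ℝ)} (hA : MeasurableSet A) (u : Hn n) :
    ∀ᵐ y, cutoff hA u y = A.indicator u y :=
  ((Lp.memLp u).indicator hA).coeFn_toLp

theorem norm_cutoff_apply_le {A : Set (Fin n → ℝ)} (hA : MeasurableSet A) (u : Hn n) :
    ‖cutoff hA u‖ ≤ ‖u‖ := by
  refine Lp.norm_le_norm_of_ae_le ?_
  filter_upwards [cutoff_ae_eq hA u] with y hy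
  exact hy ▸ norm_indicator_le_norm_self _ _

/-- The union of the translates by `c` plus lattice vectors of the cube `[1/4, 3/4)ⁿ`. -/
def innerCells (c : Fin n → ℝ) : Set (Fin n → ℝ) :=
  {y | ∀ i, Int.fract (y i - c i) ∈ Set.Ico (1 / 4 : ℝ) (3 / 4)}

theorem measurableSet_innerCells (c : Fin n → ℝ) : MeasurableSet (innerCells c) := by
  simp only [innerCells, Set.ofPred_forall]
  refine MeasurableSet.iInter fun i => ?_
  have h : Measurable fun y : Fin n → ℝ => Int.fract (y i - c i) := by fun_prop
  exact h measurableSet_Ico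

theorem cutoff_innerCells (hW : IsWeylFamily n W) (c : Fin n → ℝ) :
    cutoff (measurableSet_innerCells c)
      = W (c, 0) * cutoff (measurableSet_innerCells 0) * W (-c, 0) := by
  ext1 u
  apply Lp.ext
  filter_upwards [cutoff_ae_eq (measurableSet_innerCells c) u,
    hW.ae_eq c 0 (cutoff (measurableSet_innerCells 0) (W (-c, 0) u)),
    ae_comp_sub (cutoff_ae_eq (measurableSet_innerCells 0) (W (-c, 0) u)) c,
    ae_comp_sub (hW.ae_eq (-c) 0 u) c] with y h1 h2 h3 h4
  have hmem : y - c ∈ innerCells (0 : Fin n → ℝ) ↔ y ∈ innerCells c := by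
    simp [innerCells]
  rw [h1, mul_apply_eq_comp, mul_apply_eq_comp, h2, h3]
  by_cases h : y ∈ innerCells c
  · simp [h, hmem.mpr h, h4]
  · simp [h, mt hmem.mp h]

/-- The half-integer shifts of the inner cells partition space. -/
theorem sum_cutoff_innerCells :
    ∑ p : Fin n → Bool,
      cutoff (measurableSet_innerCells fun i => if p i then (1 / 2 : ℝ) else 0) = 1 := by
  ext1 u
  apply Lp.ext
  have hsum := Lp.coeFn_fun_finsetSum (p := 2) (μ := (volume : Measure (Fin n → ℝ))) Finset.univ
    fun p : Fin n → Bool =>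
      cutoff (measurableSet_innerCells fun i => if p i then (1 / 2 : ℝ) else 0) u
  have hcut := ae_all_iff.mpr fun p : Fin n → Bool =>
      cutoff_ae_eq (measurableSet_innerCells fun i => if p i then (1 / 2 : ℝ) else 0) u
  rw [_root_.sum_apply]
  filter_upwards [hsum, hcut] with y h1 h2
  rw [h1, one_apply_eq_self]
  simp only [h2]
  have hmem : ∀ p : Fin n → Bool, (y ∈ innerCells fun i => if p i then (1 / 2 : ℝ) else 0) ↔
      p = fun i => !decide (Int.fract (y i) ∈ Set.Ico (1 / 4 : ℝ) (3 / 4)) := by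
    intro p
    rw [funext_iff]
    refine forall_congr' fun i => ?_
    have h0 := Int.fract_nonneg (y i)
    have h1 := Int.fract_lt_one (y i)
    have h2 := Int.floor_add_fract (y i)
    cases hp : p i
    · simp [hp]
    · have hf : Int.fract (y i - 1 / 2) = if Int.fract (y i) < 1 / 2 then
          Int.fract (y i) + 1 / 2 else Int.fract (y i) - 1 / 2 := by
        rw [Int.fract_eq_iff]
        split_ifs with h
        · exact ⟨by linarith, by linarith, ⌊y i⌋ - 1, by push_cast; linarith⟩
        · exact ⟨by linarith, by linarith, ⌊y i⌋, by linarith⟩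
      simp only [hp, if_true, hf, Set.mem_Ico]
      split_ifs with h <;> simp <;> grind
  simp only [Set.indicator, hmem]
  simp

theorem isCompactOperator_of_cutoff {S : Hn n →L[ℂ] Hn n}
    (hWU : ∀ X : Xi n, W X ∈ unitary (Hn n →L[ℂ] Hn n)) (hW : IsWeylFamily n W)
    (h : ∀ c : Fin n → ℝ,
      IsCompactOperator (Tconj n W (-(c, 0)) S ∘L cutoff (measurableSet_innerCells 0))) :
    IsCompactOperator S := by
  have hS : S = ∑ p : Fin n → Bool,
      S * cutoff (measurableSet_innerCells fun i => if p i then (1 / 2 : ℝ) else 0) := by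
    rw [← Finset.mul_sum, sum_cutoff_innerCells, mul_one]
  rw [hS]
  refine Submodule.sum_mem (compactOperator (RingHom.id ℂ) (Hn n) (Hn n)) fun p _ => ?_
  set c : Fin n → ℝ := fun i => if p i then (1 / 2 : ℝ) else 0
  have h1 : W (c, 0) * W (-(c, 0)) = 1 := by
    rw [← hW.star_eq hWU, Unitary.mul_star_self_of_mem (hWU _)]
  have h2 : S * cutoff (measurableSet_innerCells c)
      = W (c, 0) * (Tconj n W (-(c, 0)) S * cutoff (measurableSet_innerCells 0)) * W (-c, 0) := by
    calc S * cutoff (measurableSet_innerCells c)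
        = (W (c, 0) * W (-(c, 0))) * S * W (c, 0) * cutoff (measurableSet_innerCells 0)
            * W (-c, 0) := by rw [cutoff_innerCells hW, h1, one_mul]; simp only [mul_assoc]
      _ = _ := by rw [Tconj, hW.star_eq hWU (-(c, 0)), neg_neg]; simp only [mul_assoc]
  rw [h2]
  exact ((h c).clm_comp (W (c, 0))).comp_clm (W (-c, 0))

end Cutoff

section DecayToCompact

variable {n : ℕ} {W : Xi n → (Hn n →L[ℂ] Hn n)}

/-- The frequency vector `2πk`. -/
def freq (k : Fin n → ℤ) : Fin n → ℝ := fun i => 2 * Real.pi * (k i : ℝ)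

theorem freq_sub (k k' : Fin n → ℤ) : freq (k - k') = freq k - freq k' := by
  ext i; simp [freq, mul_sub]

/-- The characters of phase space given by the commutation phases with lattice points. -/
def latticeChar (m : (Fin n → ℤ) × (Fin n → ℤ)) (t : Xi n) : ℂ :=
  phase (t.2 ⬝ᵥ freq m.1) * phase (-(t.1 ⬝ᵥ freq m.2))

theorem continuous_latticeChar (m : (Fin n → ℤ) × (Fin n → ℤ)) : Continuous (latticeChar m) := by
  unfold latticeChar
  simp only [dotProduct]
  fun_prop

theorem norm_latticeChar (m : (Fin n → ℤ) × (Fin n → ℤ)) (t : Xi n) : ‖latticeChar m t‖ = 1 := by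
  simp [latticeChar]

theorem integral_conj_latticeChar_mul {m m' : (Fin n → ℤ) × (Fin n → ℤ)} (h : m ≠ m') :
    ∫ t, starRingEnd ℂ (latticeChar m t) * latticeChar m' t
      ∂((volume.restrict (unitCube n)).prod (volume.restrict (unitCube n))) = 0 := by
  have h1 : ∀ t : Xi n, starRingEnd ℂ (latticeChar m t) * latticeChar m' t
      = phase (t.1 ⬝ᵥ freq (m.2 - m'.2)) * phase (t.2 ⬝ᵥ freq (m'.1 - m.1)) := fun t => by
    simp only [latticeChar, conj_phase, ← phase_add, freq_sub, dotProduct_sub]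
    congr 1
    ring
  simp only [h1]
  rw [integral_prod_mul (fun x => phase (x ⬝ᵥ freq (m.2 - m'.2)))
    (fun x => phase (x ⬝ᵥ freq (m'.1 - m.1)))]
  have hint (l : Fin n → ℤ) : ∫ y in unitCube n, phase (y ⬝ᵥ freq l) = if l = 0 then 1 else 0 :=
    integral_phase_unitCube l
  simp only [hint, sub_eq_zero]
  by_cases h2 : m.2 = m'.2
  · have h3 : m'.1 ≠ m.1 := fun h3 => h (Prod.ext h3.symm h2)
    rw [if_neg h3, mul_zero]
  · rw [if_neg h2, zero_mul]

theorem ceil_add_eq_of_fract_mem {s x : ℝ} (hs : Int.fract s ∈ Set.Ico (1 / 4 : ℝ) (3 / 4))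
    (hx0 : 0 < x) (hx : x < 1 / 4) : ⌈s + x⌉ = ⌈s⌉ := by
  have h := Int.floor_add_fract s
  have h1 : ⌈s⌉ = ⌊s⌋ + 1 := by
    rw [Int.ceil_eq_iff]
    push_cast
    constructor <;> linarith [hs.1, hs.2]
  rw [h1, Int.ceil_eq_iff]
  push_cast
  constructor <;> linarith [hs.1, hs.2]

theorem mem_unitCube_iff {y : Fin n → ℝ} : y ∈ unitCube n ↔ ∀ i, ⌈y i⌉ = 1 := by
  simp [unitCube, Int.ceil_eq_iff]

/-- The piecewise constant phase with frequency `ξ` on the lattice cubes. -/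
def stepPhase (ξ z : Fin n → ℝ) : ℂ := phase ((fun i => ((⌈z i⌉ - 1 : ℤ) : ℝ)) ⬝ᵥ ξ)

theorem measurable_stepPhase (ξ : Fin n → ℝ) : Measurable (stepPhase ξ) := by
  unfold stepPhase
  simp only [dotProduct]
  refine continuous_phase.measurable.comp (Finset.measurable_fun_sum _ fun i _ => ?_)
  refine Measurable.mul_const ?_ _
  have h : Measurable fun j : ℤ => ((j - 1 : ℤ) : ℝ) := measurable_from_top
  exact h.comp (Int.measurable_ceil.comp (measurable_pi_apply i))

theorem memLp_stepPhase_mul (x ξ : Fin n → ℝ) (v : Hn n) :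
    MemLp (fun z => stepPhase ξ z * v (z - x)) 2 (volume : Measure (Fin n → ℝ)) := by
  have h : MemLp (fun z => v (z - x)) 2 (volume : Measure (Fin n → ℝ)) :=
    (Lp.memLp v).comp_measurePreserving (measurePreserving_sub_right volume x)
  refine h.of_le ((measurable_stepPhase ξ).aestronglyMeasurable.mul h.1) (ae_of_all _ fun z => ?_)
  simp [stepPhase]

/-- Translation by `x` followed by multiplication with the step phase of frequency `ξ`. -/
def stepShift (x ξ : Fin n → ℝ) (v : Hn n) : Hn n := (memLp_stepPhase_mul x ξ v).toLp

theorem stepShift_ae_eq (x ξ : Fin n → ℝ) (v : Hn n) :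
    ∀ᵐ z, stepShift x ξ v z = stepPhase ξ z * v (z - x) :=
  (memLp_stepPhase_mul x ξ v).coeFn_toLp

theorem inner_cubeBasis_stepShift (hWU : ∀ X : Xi n, W X ∈ unitary (Hn n →L[ℂ] Hn n))
    (hW : IsWeylFamily n W) {x η : Fin n → ℝ} (hx : ∀ i, x i ∈ Set.Ioo (0 : ℝ) (1 / 4)) {v : Hn n}
    (hv : ∀ᵐ y, y ∉ innerCells (0 : Fin n → ℝ) → v y = 0) (m : (Fin n → ℤ) × (Fin n → ℤ)) :
    inner ℂ (cubeBasis hWU hW m) (stepShift x ((2 * Real.pi) • η) v)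
      = latticeChar m (x, η) * inner ℂ (cubeBasis hWU hW m) v := by
  obtain ⟨k, l⟩ := m
  set a : Fin n → ℝ := fun i => (k i : ℝ) with ha
  rw [cubeBasis_apply, latticePoint, inner_weyl_cubeFun hWU hW, inner_weyl_cubeFun hWU hW,
    mul_left_comm]
  change _ * ∫ y in unitCube n, phase (-(y ⬝ᵥ freq l)) * _ = _ * (_ * ∫ y in unitCube n,
    phase (-(y ⬝ᵥ freq l)) * _)
  congr 1
  set g : (Fin n → ℝ) → ℂ := (unitCube n).indicator fun y => phase (-(y ⬝ᵥ freq l)) * v (y + a - x)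
    with hg
  calc ∫ y in unitCube n, phase (-(y ⬝ᵥ freq l)) * stepShift x ((2 * Real.pi) • η) v (y + a)
      = ∫ y in unitCube n, phase (η ⬝ᵥ freq k) * g y := by
        have h1 := ae_comp_sub (stepShift_ae_eq x ((2 * Real.pi) • η) v) (-a)
        refine integral_congr_ae ?_
        filter_upwards [ae_restrict_of_ae h1, ae_restrict_mem measurableSet_unitCube] with y hy hmem
        rw [sub_neg_eq_add] at hy
        have h2 : stepPhase ((2 * Real.pi) • η) (y + a) = phase (η ⬝ᵥ freq k) := by
          have h3 := eq_ceil_of_sub_mem_unitCube (y := y + a) (k := k)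
            (by rwa [← ha, add_sub_cancel_right])
          simp only [stepPhase, ← h3, dotProduct, freq]
          congr 1
          refine Finset.sum_congr rfl fun i _ => ?_
          simp
          ring
        rw [hy, h2, hg, Set.indicator_of_mem hmem]
        ring
    _ = phase (η ⬝ᵥ freq k) * ∫ y in unitCube n, g y := integral_const_mul _ _
    _ = phase (η ⬝ᵥ freq k) * ∫ y, g y := by
        rw [hg, setIntegral_indicator measurableSet_unitCube, Set.inter_self,
          integral_indicator measurableSet_unitCube]
    _ = phase (η ⬝ᵥ freq k) * ∫ y, g (y + x) := by rw [integral_add_right_eq_self]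
    _ = phase (η ⬝ᵥ freq k) * ∫ y, phase (-(x ⬝ᵥ freq l)) *
          (unitCube n).indicator (fun y => phase (-(y ⬝ᵥ freq l)) * v (y + a)) y := by
        congr 1
        refine integral_congr_ae ?_
        have h1 := ae_comp_sub hv (-a)
        filter_upwards [h1] with y hy
        rw [sub_neg_eq_add] at hy
        have h2 : y + x + a - x = y + a := by abel
        by_cases hmem : y + a ∈ innerCells (0 : Fin n → ℝ)
        · have h3 : y + x ∈ unitCube n ↔ y ∈ unitCube n := by
            rw [mem_unitCube_iff, mem_unitCube_iff]
            refine forall_congr' fun i => ?_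
            have h4 := hmem i
            simp only [Pi.add_apply, ha, Pi.zero_apply, sub_zero, Int.fract_add_intCast] at h4
            rw [Pi.add_apply, ceil_add_eq_of_fract_mem h4 (hx i).1 (hx i).2]
          by_cases hy' : y ∈ unitCube n
          · rw [hg, Set.indicator_of_mem (h3.mpr hy'), Set.indicator_of_mem hy', h2, ← mul_assoc,
              ← phase_add, add_dotProduct]
            congr 2
            ring
          · rw [hg, Set.indicator_of_notMem (mt h3.mp hy'), Set.indicator_of_notMem hy', mul_zero]
        · simp [hg, Set.indicator, h2, hy hmem]
    _ = _ := by
        rw [integral_const_mul, integral_indicator measurableSet_unitCube, ← mul_assoc, latticeChar]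

theorem norm_stepShift_sub_le (hW : IsWeylFamily n W)
    (hWU : ∀ X : Xi n, W X ∈ unitary (Hn n →L[ℂ] Hn n)) {x ξ : Fin n → ℝ} {δ : ℝ}
    (hx : ∀ i, x i ∈ Set.Ioo (0 : ℝ) (1 / 4)) (hξ : ∀ i, |ξ i| ≤ δ) (v : Hn n) :
    ‖stepShift x ξ v - W (x, ξ) v‖ ≤ n * δ * ‖v‖ := by
  rw [← norm_unitary_apply (hWU (x, ξ)) v]
  refine Lp.norm_le_mul_norm_of_ae_le_mul ?_
  filter_upwards [Lp.coeFn_sub (stepShift x ξ v) (W (x, ξ) v), stepShift_ae_eq x ξ v,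
    hW.ae_eq x ξ v] with z h1 h2 h3
  rw [h1, Pi.sub_apply, h2, h3, ← sub_mul, norm_mul, norm_mul, norm_phase, one_mul]
  refine mul_le_mul_of_nonneg_right ?_ (norm_nonneg _)
  refine (norm_phase_sub_le _ _).trans ?_
  rw [← sub_dotProduct, dotProduct]
  refine (Finset.abs_sum_le_sum_abs _ _).trans ?_
  have h4 : ∀ i ∈ Finset.univ, |((fun i => ((⌈z i⌉ - 1 : ℤ) : ℝ)) - (z - (2⁻¹ : ℝ) • x)) i * ξ i|
      ≤ δ := by
    intro i _
    have h5 := Int.le_ceil (z i)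
    have h6 := Int.ceil_lt_add_one (z i)
    obtain ⟨h7, h8⟩ := hx i
    have h9 : |((fun i => ((⌈z i⌉ - 1 : ℤ) : ℝ)) - (z - (2⁻¹ : ℝ) • x)) i| ≤ 1 := by
      simp only [Pi.sub_apply, Pi.smul_apply, smul_eq_mul, abs_le]
      push_cast
      constructor <;> linarith
    rw [abs_mul]
    calc _ ≤ 1 * |ξ i| := by gcongr
      _ ≤ δ := by rw [one_mul]; exact hξ i
  simpa using Finset.sum_le_card_nsmul _ _ _ h4

/-- A small box in phase space with positive coordinates. -/
def smallBox (n : ℕ) (δ : ℝ) : Set (Xi n) :=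
  (Set.univ.pi fun _ => Set.Ioc 0 δ) ×ˢ (Set.univ.pi fun _ => Set.Ioc 0 δ)

theorem measurableSet_smallBox (δ : ℝ) : MeasurableSet (smallBox n δ) :=
  (MeasurableSet.univ_pi fun _ => measurableSet_Ioc).prod
    (MeasurableSet.univ_pi fun _ => measurableSet_Ioc)

theorem smallBox_pos {δ : ℝ} (h0 : 0 < δ) (h1 : δ ≤ 1) :
    0 < ((volume.restrict (unitCube n)).prod (volume.restrict (unitCube n))) (smallBox n δ) := by
  have hsub : (Set.univ.pi fun _ => Set.Ioc 0 δ) ⊆ unitCube n :=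
    Set.pi_mono fun _ _ => Set.Ioc_subset_Ioc_right h1
  have h : 0 < volume.restrict (unitCube n) (Set.univ.pi fun _ => Set.Ioc 0 δ) := by
    rw [Measure.restrict_apply (MeasurableSet.univ_pi fun _ => measurableSet_Ioc),
      Set.inter_eq_left.mpr hsub, volume_pi_pi]
    simp [h0, pos_iff_ne_zero]
  rw [smallBox, Measure.prod_prod]
  exact ENNReal.mul_pos h.ne' h.ne'

theorem isCompactOperator_comp_cutoff (hWU : ∀ X : Xi n, W X ∈ unitary (Hn n →L[ℂ] Hn n))
    (hW : IsWeylFamily n W) {S : Hn n →L[ℂ] Hn n} (hS : S ∈ B0 n W)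
    (hdec : ∀ u, Tendsto (fun X : Xi n => ‖Tconj n W X S u‖) (cocompact (Xi n)) (𝓝 0)) :
    IsCompactOperator (S ∘L cutoff (measurableSet_innerCells (0 : Fin n → ℝ))) := by
  refine isCompactOperator_comp_of_diagonal
    ((volume.restrict (unitCube n)).prod (volume.restrict (unitCube n)))
    (cubeBasis hWU hW) latticeChar (fun m => (continuous_latticeChar m).measurable)
    norm_latticeChar (fun _ _ h => integral_conj_latticeChar_mul h) S _ ?_ fun ε hε => ?_
  · have h1 : Tendsto (fun m : (Fin n → ℤ) × (Fin n → ℤ) => latticePoint (-m)) cofinite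
        (cocompact (Xi n)) :=
      tendsto_latticePoint_cofinite.comp neg_injective.tendsto_cofinite
    refine ((hdec (cubeFun n)).comp h1).congr fun m => ?_
    have h2 : -latticePoint (-m) = latticePoint m := by ext i <;> simp [latticePoint]
    rw [Function.comp_apply, norm_Tconj_apply hWU, hW.star_eq hWU, h2, cubeBasis_apply]
  · have hcont : Continuous fun t : Xi n => ‖Tconj n W (t.1, (2 * Real.pi) • t.2) S - S‖ := by
      have h : Continuous fun X : Xi n => Tconj n W X S := hS
      exact ((h.comp (by fun_prop : Continuous fun t : Xi n =>
        ((t.1, (2 * Real.pi) • t.2) : Xi n))).sub continuous_const).norm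
    have h0 : Tendsto (fun t : Xi n => ‖Tconj n W (t.1, (2 * Real.pi) • t.2) S - S‖) (𝓝 0)
        (𝓝 0) := by
      refine (hcont.tendsto 0).trans (by simp [Prod.mk_zero_zero, Tconj_zero hW])
    obtain ⟨ρ, hρ, hball⟩ := Metric.eventually_nhds_iff_ball.mp
      (h0.eventually_lt_const (half_pos hε))
    set C : ℝ := ‖S‖ * (n * (2 * Real.pi)) with hC
    have hC0 : 0 ≤ C := by positivity
    obtain ⟨δ, hδ0, hδ⟩ : ∃ δ > 0, δ < min (1 / 4) (min ρ (ε / (2 * (C + 1)))) :=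
      exists_between (by positivity)
    simp only [lt_min_iff] at hδ
    obtain ⟨hδ1, hδρ, hδε⟩ := hδ
    refine ⟨smallBox n δ, measurableSet_smallBox δ, smallBox_pos hδ0 (by linarith),
      fun t ht u => ?_⟩
    have hx : ∀ i, t.1 i ∈ Set.Ioo (0 : ℝ) (1 / 4) := fun i =>
      ⟨(ht.1 i trivial).1, (ht.1 i trivial).2.trans_lt hδ1⟩
    have hξ : ∀ i, |((2 * Real.pi) • t.2) i| ≤ 2 * Real.pi * δ := fun i => by
      rw [Pi.smul_apply, smul_eq_mul, abs_of_nonneg (mul_nonneg Real.two_pi_pos.le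
        (ht.2 i trivial).1.le)]
      exact mul_le_mul_of_nonneg_left (ht.2 i trivial).2 Real.two_pi_pos.le
    have htρ : t ∈ Metric.ball 0 ρ := by
      rw [mem_ball_zero_iff, Prod.norm_def, max_lt_iff]
      constructor <;> refine ((pi_norm_le_iff_of_nonneg hδ0.le).mpr fun i => ?_).trans_lt hδρ
      · rw [Real.norm_of_nonneg (ht.1 i trivial).1.le]
        exact (ht.1 i trivial).2
      · rw [Real.norm_of_nonneg (ht.2 i trivial).1.le]
        exact (ht.2 i trivial).2
    set v := cutoff (measurableSet_innerCells (0 : Fin n → ℝ)) u with hv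
    set w := stepShift t.1 ((2 * Real.pi) • t.2) v
    have hvu : ‖v‖ ≤ ‖u‖ := norm_cutoff_apply_le _ u
    refine ⟨w, fun m => inner_cubeBasis_stepShift hWU hW hx ?_ m, ?_⟩
    · filter_upwards [cutoff_ae_eq (measurableSet_innerCells (0 : Fin n → ℝ)) u] with y hy hmem
      rw [hv, hy, Set.indicator_of_notMem hmem]
    · set X : Xi n := (t.1, (2 * Real.pi) • t.2)
      have h1 := norm_apply_le_of_Tconj_sub hWU S X v
      have h2 : ‖Tconj n W X S - S‖ * ‖v‖ ≤ ε / 2 * ‖u‖ := by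
        gcongr
        exact (hball t htρ).le
      have h3 : ‖S (W X v)‖ ≤ ‖S w‖ + ‖S (w - W X v)‖ := by
        have : S (W X v) = S w - S (w - W X v) := by rw [map_sub]; abel
        rw [this]
        exact norm_sub_le _ _
      have h4 : ‖S (w - W X v)‖ ≤ C * δ * ‖u‖ :=
        calc ‖S (w - W X v)‖ ≤ ‖S‖ * (n * (2 * Real.pi * δ) * ‖v‖) :=
              (S.le_opNorm _).trans (mul_le_mul_of_nonneg_left
                (norm_stepShift_sub_le hW hWU hx hξ v) (norm_nonneg _))
          _ = C * δ * ‖v‖ := by rw [hC]; ring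
          _ ≤ C * δ * ‖u‖ := by gcongr
      have h5 : C * δ ≤ ε / 2 := by
        rw [lt_div_iff₀ (by positivity)] at hδε
        nlinarith
      have h6 : C * δ * ‖u‖ ≤ ε / 2 * ‖u‖ := by gcongr
      linarith

theorem isCompactOperator_of_tendsto_norm_Tconj
    (hWU : ∀ X : Xi n, W X ∈ unitary (Hn n →L[ℂ] Hn n)) (hW : IsWeylFamily n W)
    {S : Hn n →L[ℂ] Hn n} (hS : S ∈ B0 n W)
    (hdec : ∀ u, Tendsto (fun X : Xi n => ‖Tconj n W X S u‖) (cocompact (Xi n)) (𝓝 0)) :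
    IsCompactOperator S :=
  isCompactOperator_of_cutoff hWU hW fun c =>
    isCompactOperator_comp_cutoff hWU hW (Tconj_mem_B0 hW hS _) fun u => by
      simp only [← Tconj_add hW]
      exact (hdec u).comp
        (Homeomorph.addRight (-(c, 0) : Xi n)).isClosedEmbedding.tendsto_cocompact

end DecayToCompact

/-- `S ∈ B⁰(H)` is compact iff `T_X(S) → 0` *-strongly along the
cocompact (Fréchet) filter on `Ξ`. -/
theorem statement7 (n : ℕ) (W : Xi n → (Hn n →L[ℂ] Hn n))
    (hW : IsWeylFamily n W) (hWU : ∀ X : Xi n, W X ∈ unitary (Hn n →L[ℂ] Hn n))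
    (S : Hn n →L[ℂ] Hn n) (hS : S ∈ B0 n W) :
    IsCompactOperator (⇑S) ↔
      ∀ u : Hn n,
        Tendsto (fun X : Xi n => ‖Tconj n W X S u‖) (cocompact (Xi n)) (𝓝 0) ∧
        Tendsto (fun X : Xi n => ‖star (Tconj n W X S) u‖) (cocompact (Xi n))
          (𝓝 0) := by
  refine ⟨fun hc u => ⟨tendsto_norm_Tconj_of_isCompactOperator hWU hW hS hc u,
    tendsto_norm_star_Tconj_of_isCompactOperator hWU hW hS hc u⟩, fun h =>
    isCompactOperator_of_tendsto_norm_Tconj hWU hW hS fun u => (h u).1⟩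
end
end
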